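/- arXiv:1503.08546 — 4 statements merged into one kernel-verified Lean document; each statement's English description precedes it below -/
import Mathlib

section
/- For every n ≥ 0, the variational derivative of the Gelfand–Dickey polynomial R_{n+1} equals R_n: δ R_{n+1} = R_n. -/
open MvPolynomial

/-- The derivation `∂ₓ = Σ_{k≥0} u_{k+1} ∂/∂u_k` on `A = ℝ[u₀, u₁, …]`
(the sum is finite on each polynomial). -/
noncomputable def dx (f : MvPolynomial ℕ ℝ) : MvPolynomial ℕ ℝ :=
  ∑ᶠ k : ℕ, X (k + 1) * pderiv k f

/-- The λ-linear extension of `∂ₓ` to `A[λ]` (acting on coefficients). -/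
noncomputable def dxP (p : Polynomial (MvPolynomial ℕ ℝ)) :
    Polynomial (MvPolynomial ℕ ℝ) :=
  p.sum fun n a => Polynomial.C (dx a) * Polynomial.X ^ n

/-- `p ∈ A[λ]` has zero constant term: the constant term (in the variables `u_k`)
of every `λ`-coefficient of `p` vanishes. -/
def NoConst (p : Polynomial (MvPolynomial ℕ ℝ)) : Prop :=
  ∀ i : ℕ, coeff 0 (p.coeff i) = 0

/-- `R : ℕ → A[λ]` is the sequence of Gelfand–Dickey polynomials:
`R 0 = 1`, each `R n` for `n ≥ 1` has zero constant term, and the Lenard recursion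
`(2n+1) ∂ₓ R_{n+1} = u₁ R_n + 2 u₀ ∂ₓ R_n + (λ²/4) ∂ₓ³ R_n` holds. -/
def IsGD (R : ℕ → Polynomial (MvPolynomial ℕ ℝ)) : Prop :=
  R 0 = 1 ∧ (∀ n : ℕ, 1 ≤ n → NoConst (R n)) ∧
  ∀ n : ℕ,
    Polynomial.C (MvPolynomial.C (2 * (n : ℝ) + 1)) * dxP (R (n + 1)) =
      Polynomial.C (X 1) * R n
      + Polynomial.C (MvPolynomial.C 2 * X 0) * dxP (R n)
      + Polynomial.C (MvPolynomial.C (1 / 4 : ℝ)) * Polynomial.X ^ 2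
          * dxP (dxP (dxP (R n)))

/-- The λ-linear extension of the variational derivative
`δ = Σ_{k≥0} (−1)^k ∂ₓ^k ∘ (∂/∂u_k)` to `A[λ]`. -/
noncomputable def delta (f : MvPolynomial ℕ ℝ) : MvPolynomial ℕ ℝ :=
  ∑ᶠ k : ℕ, ((-1 : ℝ) ^ k) • (dx^[k] (pderiv k f))

/-- The λ-linear extension of `δ` to `A[λ]` (acting on coefficients). -/
noncomputable def deltaP (p : Polynomial (MvPolynomial ℕ ℝ)) :
    Polynomial (MvPolynomial ℕ ℝ) :=
  p.sum fun n a => Polynomial.C (delta a) * Polynomial.X ^ n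

namespace GDProof

abbrev A := MvPolynomial ℕ ℝ

/-! ### Coefficientwise maps on power series -/

noncomputable def psMap {R G : Type*} [CommRing R] [CommRing G] (f : R →+ G) :
    PowerSeries R →+ PowerSeries G where
  toFun p := PowerSeries.mk fun n => f (PowerSeries.coeff n p)
  map_zero' := by ext n; simp
  map_add' p q := by ext n; simp

theorem coeff_psMap {R G : Type*} [CommRing R] [CommRing G] (f : R →+ G) (n : ℕ)
    (p : PowerSeries R) : PowerSeries.coeff n (psMap f p) = f (PowerSeries.coeff n p) := by
  simp [psMap]

theorem psMap_leib {R G : Type*} [CommRing R] [CommRing G] (ι : R →+* G) (D : R →+ G)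
    (h : ∀ a b, D (a * b) = ι a * D b + ι b * D a) (a b : PowerSeries R) :
    psMap D (a * b) = PowerSeries.map ι a * psMap D b + PowerSeries.map ι b * psMap D a := by
  ext n
  rw [mul_comm (PowerSeries.map ι b)]
  simp only [coeff_psMap, PowerSeries.coeff_mul, map_add, map_sum, h, Finset.sum_add_distrib,
    PowerSeries.coeff_map]
  congr 1
  exact Finset.sum_congr rfl fun _ _ => mul_comm _ _

theorem psMap_leib2 {R G : Type*} [CommRing R] [CommRing G] (ι : R →+* G) (d : R →+ R)
    (N : G →+ G) (h : ∀ a b, N (ι a * b) = ι a * N b + ι (d a) * b)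
    (a : PowerSeries R) (b : PowerSeries G) :
    psMap N (PowerSeries.map ι a * b) =
      PowerSeries.map ι a * psMap N b + PowerSeries.map ι (psMap d a) * b := by
  ext n
  simp only [coeff_psMap, PowerSeries.coeff_mul, map_add, map_sum, h, Finset.sum_add_distrib,
    PowerSeries.coeff_map]

theorem psMap_X {R G : Type*} [CommRing R] [CommRing G] (f : R →+ G) (h : f 1 = 0) :
    psMap f PowerSeries.X = 0 := by
  ext n
  rw [coeff_psMap, PowerSeries.coeff_X]
  split_ifs <;> simp [h]

theorem psMap_C {R G : Type*} [CommRing R] [CommRing G] (f : R →+ G) (a : R) :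
    psMap f (PowerSeries.C a) = PowerSeries.C (f a) := by
  ext n
  rw [coeff_psMap, PowerSeries.coeff_C, PowerSeries.coeff_C]
  split_ifs <;> simp

/-- Euler operator `z d/dz`. -/
noncomputable def theta {R : Type*} [CommRing R] : PowerSeries R →+ PowerSeries R where
  toFun p := PowerSeries.mk fun n => (n : R) * PowerSeries.coeff n p
  map_zero' := by ext n; simp
  map_add' p q := by ext n; simp [mul_add]

theorem coeff_theta {R : Type*} [CommRing R] (n : ℕ) (p : PowerSeries R) :
    PowerSeries.coeff n (theta p) = (n : R) * PowerSeries.coeff n p := by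
  simp [theta]

theorem theta_leib {R : Type*} [CommRing R] (a b : PowerSeries R) :
    theta (a * b) = a * theta b + b * theta a := by
  ext n
  rw [mul_comm b]
  simp only [coeff_theta, PowerSeries.coeff_mul, map_add, Finset.mul_sum,
    ← Finset.sum_add_distrib]
  refine Finset.sum_congr rfl fun x hx => ?_
  rw [← Finset.HasAntidiagonal.mem_antidiagonal.1 hx]
  push_cast
  ring

theorem theta_X {R : Type*} [CommRing R] :
    theta (PowerSeries.X : PowerSeries R) = PowerSeries.X := by
  ext n
  rw [coeff_theta, PowerSeries.coeff_X]
  split_ifs with h <;> simp [h]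

theorem theta_C {R : Type*} [CommRing R] (a : R) :
    theta (PowerSeries.C a) = 0 := by
  ext n
  rw [coeff_theta, PowerSeries.coeff_C]
  split_ifs with h <;> simp [h]

theorem theta_psMap {R : Type*} [CommRing R] (d : R →+ R) (p : PowerSeries R) :
    theta (psMap d p) = psMap d (theta p) := by
  ext n
  rw [coeff_theta, coeff_psMap, coeff_psMap, coeff_theta, ← nsmul_eq_mul, ← nsmul_eq_mul,
    map_nsmul]

/-! ### The abstract argument -/

theorem abs_quad {K : Type*} [CommRing K] (d : K →+ K)
    (hd : ∀ a b, d (a * b) = a * d b + b * d a)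
    (S z u ε : K) (dz : d z = 0) (dε : d ε = 0)
    (rec : d S = z * (d u * S + 2 * u * d S + ε * d (d (d S)))) :
    d (S * S - 2 * (u * (z * (S * S))) - z * (ε * (2 * (S * d (d S)) - d S * d S))) = 0 := by
  have d1 : d 1 = 0 := by have := hd 1 1; simpa using this
  have h2 : d 2 = 0 := by rw [← one_add_one_eq_two, map_add, d1, add_zero]
  simp only [map_sub, hd, h2, dz, dε]
  linear_combination 2 * S * rec

theorem abs_main {K L : Type*} [CommRing K] [CommRing L] (ι : K →+* L)
    (d : K →+ K) (θ : K →+ K) (D : K →+ L) (N : L →+ L)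
    (hd : ∀ a b, d (a * b) = a * d b + b * d a)
    (hθ : ∀ a b, θ (a * b) = a * θ b + b * θ a)
    (hD : ∀ a b, D (a * b) = ι a * D b + ι b * D a)
    (hN : ∀ a b, N (ι a * b) = ι a * N b + ι (d a) * b)
    (hθd : ∀ a, θ (d a) = d (θ a)) (hDd : ∀ a, D (d a) = N (D a))
    (S Q z u ε : K) (hQ : S * Q = 1)
    (dz : d z = 0) (dε : d ε = 0) (θz : θ z = z) (θu : θ u = 0) (θε : θ ε = 0)
    (Dz : D z = 0) (Dε : D ε = 0) (Du : D u = 1)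
    (quad : S * S - 2 * (u * (z * (S * S))) - z * (ε * (2 * (S * d (d S)) - d S * d S)) = 1) :
    2 * (ι z * (D S - ι (z * (2 * θ S + S)))) =
      2 * (ι z * N (ι (ε * Q) * (ι (z * (2 * θ S + S)) * N (D S)
        - ι (d (z * (2 * θ S + S))) * D S))) := by
  have d2 : ∀ x, d (2 * x) = 2 * d x := fun x => by rw [two_mul, map_add, two_mul]
  have d1 : d 1 = 0 := by have := hd 1 1; simpa using this
  have t1 : θ 1 = 0 := by have := hθ 1 1; simpa using this
  have D1 : D 1 = 0 := by have := hD 1 1; simpa using this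
  have t2 : θ 2 = 0 := by rw [← one_add_one_eq_two, map_add, t1, add_zero]
  have D2 : D 2 = 0 := by rw [← one_add_one_eq_two, map_add, D1, add_zero]
  have eθ := congrArg θ quad
  have eD := congrArg D quad
  simp only [map_sub, hθ, hD, t2, D2, t1, D1, θz, θu, θε, Dz, Dε, Du, hθd, hDd, map_mul] at eθ eD
  -- derivative of the inverse
  have eQ : d Q = - (Q * Q * d S) := by
    have := congrArg d hQ
    rw [hd, d1] at this
    linear_combination Q * this - d Q * hQ
  -- L(T) = 2 z S^2
  set T := z * (2 * θ S + S) with hT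
  have T1 : d T = z * (2 * d (θ S) + d S) := by
    rw [hT, hd, dz, map_add, d2]; ring
  have T2 : d (d T) = z * (2 * d (d (θ S)) + d (d S)) := by
    rw [T1, hd, dz, map_add, d2]; ring
  have LT : 2 * (1 - 2 * u * z) * S * T
      - z * ε * (2 * T * d (d S) + 2 * S * d (d T) - 2 * d S * d T) = 2 * z * (S * S) := by
    rw [T2, T1, hT]
    linear_combination 2 * z * eθ
  clear_value T
  have LTι := congrArg ι LT
  have hQι := congrArg ι hQ
  simp only [map_sub, map_mul, map_add, map_one, map_ofNat] at LTι hQι eD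
  rw [mul_sub (ι (ε * Q)), map_sub, ← mul_assoc (ι (ε * Q)), ← mul_assoc (ι (ε * Q)), ← map_mul, ← map_mul, hN, hN]
  have e1 : d (ε * Q * T) = ε * (Q * d T - Q * Q * d S * T) := by
    rw [hd, hd, dε, eQ]; ring
  have e2 : d (ε * Q * d T) = ε * (Q * d (d T) - Q * Q * d S * d T) := by
    rw [hd, hd, dε, eQ]; ring
  rw [e1, e2]
  simp only [map_sub, map_mul]
  generalize ι (d (d T)) = T2 at *
  generalize ι (d T) = T1 at *
  generalize ι T = T0 at *
  generalize ι (d (d S)) = S2 at *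
  generalize ι (d S) = S1 at *
  generalize ι S = S0 at *
  generalize ι Q = q at *
  generalize N (N (D S)) = w2 at *
  generalize N (D S) = w1 at *
  generalize D S = w at *
  generalize ι z = Z at *
  generalize ι ε = E at *
  generalize ι u = U at *
  have key : 2 * Z * (S0 * S0) * (w - T0) = 2 * Z * E * (S0 * (T0 * w2 - T2 * w)
      - S1 * (T0 * w1 - T1 * w)) := by
    linear_combination T0 * eD - w * LTι
  have hq2 : S0 * S0 * (q * q) = 1 := by
    linear_combination (S0 * q + 1) * hQι
  linear_combination q * q * key - 2 * Z * (w - T0) * hq2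
    + 2 * Z * E * q * (T0 * w2 - T2 * w) * hQι

/-! ### The concrete derivations -/

theorem fin_supp (f : A) : (Function.support fun k => pderiv k f).Finite := by
  refine (Finset.finite_toSet f.vars).subset fun k hk => ?_
  by_contra h
  exact hk (pderiv_eq_zero_of_notMem_vars h)

theorem fin_supp' (f : A) (g : ℕ → A) :
    (Function.support fun k => g k * pderiv k f).Finite := by
  refine (fin_supp f).subset fun k hk h => hk ?_
  simp only at h
  simp [h]

noncomputable def dxD : Derivation ℝ A A := mkDerivation ℝ fun k => X (k + 1)

theorem dx_add (f g : A) : dx (f + g) = dx f + dx g := by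
  unfold dx
  rw [← finsum_add_distrib (fin_supp' f _) (fin_supp' g _)]
  simp [mul_add]

theorem dx_mul (f g : A) : dx (f * g) = f * dx g + g * dx f := by
  unfold dx
  rw [mul_finsum, mul_finsum, ← finsum_add_distrib]
  · refine finsum_congr fun k => ?_
    rw [pderiv_mul]; ring
  · simp_rw [← mul_assoc]; exact fin_supp' g _
  · simp_rw [← mul_assoc]; exact fin_supp' f _

theorem dx_C (r : ℝ) : dx (C r) = 0 := by
  simp [dx]

theorem dx_X (n : ℕ) : dx (X n) = X (n + 1) := by
  unfold dx
  rw [finsum_eq_single _ n]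
  · simp
  · intro k hk
    rw [pderiv_X_of_ne hk.symm, mul_zero]

theorem dx_eq (f : A) : dx f = dxD f := by
  induction f using MvPolynomial.induction_on with
  | C a => rw [dx_C, dxD, derivation_C]
  | add p q hp hq => rw [dx_add, hp, hq, map_add]
  | mul_X p n hp => rw [dx_mul, Derivation.leibniz, hp, dx_X, dxD, mkDerivation_X]; simp

noncomputable def dA : A →+ A := dxD.toLinearMap.toAddMonoidHom

theorem dA_apply (f : A) : dA f = dxD f := rfl

theorem dx_eq' (f : A) : dx f = dA f := dx_eq f

theorem dx_fun : dx = dA := funext dx_eq'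

theorem dA_mul (f g : A) : dA (f * g) = f * dA g + g * dA f := by
  simp only [← dx_eq', dx_mul]

theorem comm_succ (k : ℕ) (f : A) :
    pderiv (k + 1) (dxD f) = dxD (pderiv (k + 1) f) + pderiv k f := by
  have h : ⁅(pderiv (k + 1) : Derivation ℝ A A), dxD⁆ = pderiv k := by
    refine derivation_ext fun i => ?_
    rw [Derivation.commutator_apply]
    simp only [dxD, mkDerivation_X, pderiv_X]
    by_cases hik : i = k
    · subst hik
      by_cases h : i = i + 1 <;> simp [Pi.single_apply]
    · have : pderiv (R := ℝ) (k+1) (X i : A) = 0 ∨ pderiv (R := ℝ) (k+1) (X i : A) = 1 := by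
        rw [pderiv_X, Pi.single_apply]; split_ifs <;> simp
      rw [← pderiv_X (R := ℝ) (k+1) i]
      rcases this with h | h <;> simp [h, Pi.single_apply, hik]
  have := DFunLike.congr_fun h f
  rw [Derivation.commutator_apply] at this
  rw [← this]; ring

theorem comm_zero (f : A) : pderiv 0 (dxD f) = dxD (pderiv 0 f) := by
  have h : ⁅(pderiv 0 : Derivation ℝ A A), dxD⁆ = 0 := by
    refine derivation_ext fun i => ?_
    rw [Derivation.commutator_apply]
    have : pderiv (R := ℝ) 0 (X i : A) = 0 ∨ pderiv (R := ℝ) 0 (X i : A) = 1 := by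
      rw [pderiv_X, Pi.single_apply]; split_ifs <;> simp
    rcases this with h | h <;> simp [h, dxD, mkDerivation_X, pderiv_X]
  have := DFunLike.congr_fun h f
  rw [Derivation.commutator_apply] at this
  exact sub_eq_zero.1 this

/-- the kernel of `∂ₓ` consists of constants -/
theorem ker_dA (f : A) (h : dA f = 0) : f = C (constantCoeff f) := by
  rw [dA_apply] at h
  have step : ∀ k, pderiv (k + 1) f = 0 → pderiv k f = 0 := by
    intro k hk
    have := comm_succ k f
    rw [h, hk] at this
    simpa using this.symm
  have down : ∀ m k, pderiv (k + m) f = 0 → pderiv k f = 0 := by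
    intro m
    induction m with
    | zero => intro k hk; exact hk
    | succ m ih => intro k hk; exact ih k (step _ hk)
  have all : ∀ k, pderiv k f = 0 := by
    intro k
    refine down (f.vars.sup id + 1) k (pderiv_eq_zero_of_notMem_vars fun hm => ?_)
    have := Finset.le_sup (f := id) hm
    simp only [id] at this
    omega
  ext m
  rw [coeff_C]
  split_ifs with hm
  · rw [← hm]; rfl
  · obtain ⟨i, hi⟩ : ∃ i, m i ≠ 0 := by
      by_contra hc
      push Not at hc
      exact hm (Finsupp.ext fun i => (hc i).symm)
    have e := congrArg (coeff (m - Finsupp.single i 1)) (all i)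
    rw [coeff_pderiv, coeff_zero] at e
    have hs : m - Finsupp.single i 1 + Finsupp.single i 1 = m := by
      ext j
      by_cases hj : j = i
      · subst hj; simp; omega
      · simp [Finsupp.single_apply, Ne.symm hj]
    rw [hs] at e
    rcases mul_eq_zero.1 e with e | e
    · exact e
    · exfalso
      have : (0 : ℝ) < ((m - Finsupp.single i 1 : ℕ →₀ ℕ) i : ℝ) + 1 := by positivity
      exact this.ne' e

theorem const_dA (f : A) : constantCoeff (dA f) = 0 := by
  rw [← dx_eq']
  induction f using MvPolynomial.induction_on with
  | C a => simp [dx_C]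
  | add p q hp hq => rw [dx_add, map_add, hp, hq, add_zero]
  | mul_X p n hp => rw [dx_mul, dx_X]; simp

/-! ### Frechet derivative and the formal adjoint -/

abbrev G := Polynomial A

noncomputable def DG : Derivation ℝ A G := mkDerivation ℝ fun k => (Polynomial.X : G) ^ k

noncomputable def DA : A →+ G := DG.toLinearMap.toAddMonoidHom

theorem coeff_DG (k : ℕ) (f : A) : (DG f).coeff k = pderiv k f := by
  have : (Polynomial.lcoeff A k).compDer DG = (pderiv k : Derivation ℝ A A) := by
    refine derivation_ext fun i => ?_
    change (DG (X i)).coeff k = _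
    rw [DG, mkDerivation_X, Polynomial.coeff_X_pow, pderiv_X, Pi.single_apply]
    simp only [eq_comm]
  exact DFunLike.congr_fun this f

theorem DA_apply (f : A) : DA f = DG f := rfl

theorem DA_mul (f g : A) :
    DA (f * g) = (Polynomial.C : A →+* G) f * DA g + (Polynomial.C : A →+* G) g * DA f := by
  rw [DA_apply, Derivation.leibniz, Polynomial.smul_eq_C_mul, Polynomial.smul_eq_C_mul]; rfl

theorem coeff_sumC (F : A → A) (hF : F 0 = 0) (p : G) (i : ℕ) :
    (p.sum fun n a => Polynomial.C (F a) * Polynomial.X ^ n).coeff i = F (p.coeff i) := by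
  rw [Polynomial.sum_def, Polynomial.finsetSum_coeff]
  simp only [Polynomial.coeff_C_mul_X_pow]
  rw [Finset.sum_ite_eq]
  split_ifs with h
  · rfl
  · rw [Polynomial.notMem_support_iff.1 h, hF]

theorem coeff_dxP (p : G) (i : ℕ) : (dxP p).coeff i = dA (p.coeff i) := by
  rw [dxP, coeff_sumC _ (by rw [dx_eq', map_zero]), dx_eq']

theorem delta_zero : delta 0 = 0 := by
  unfold delta
  rw [dx_fun]
  simp [iterate_map_zero]

theorem coeff_deltaP (p : G) (i : ℕ) : (deltaP p).coeff i = delta (p.coeff i) := by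
  rw [deltaP, coeff_sumC _ delta_zero]

/-- `∇ = ∂ₓ + ξ`. -/
noncomputable def N : G →+ G where
  toFun p := dxP p + Polynomial.X * p
  map_zero' := by ext1 i; simp [coeff_dxP]
  map_add' p q := by
    rw [mul_add]
    ext1 i
    simp only [Polynomial.coeff_add, coeff_dxP, map_add]
    ring

theorem N_apply (p : G) : N p = dxP p + Polynomial.X * p := rfl

theorem N_leib (a : A) (p : G) : N ((Polynomial.C : A →+* G) a * p) =
    (Polynomial.C : A →+* G) a * N p + (Polynomial.C : A →+* G) (dA a) * p := by
  rw [N_apply, N_apply, mul_add, mul_left_comm]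
  ext1 i
  simp only [Polynomial.coeff_add, coeff_dxP, Polynomial.coeff_C_mul, dA_mul]
  ring

theorem DA_dA (f : A) : DA (dA f) = N (DA f) := by
  ext1 i
  rw [N_apply, Polynomial.coeff_add, coeff_dxP, DA_apply, DA_apply, coeff_DG, coeff_DG]
  cases i with
  | zero => simp [dA_apply, comm_zero]
  | succ k => rw [Polynomial.coeff_X_mul, coeff_DG, dA_apply, dA_apply, comm_succ]

noncomputable def ev : G →+ A where
  toFun p := p.sum fun k a => ((-1 : ℝ) ^ k) • (dA^[k] a)
  map_zero' := by simp
  map_add' p q := by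
    refine Polynomial.sum_add_index p q _ (fun i => by simp [iterate_map_zero]) fun k a b => ?_
    rw [iterate_map_add, smul_add]

theorem ev_monomial (k : ℕ) (a : A) :
    ev (Polynomial.monomial k a) = ((-1 : ℝ) ^ k) • (dA^[k] a) :=
  Polynomial.sum_monomial_index a (fun k a => ((-1 : ℝ) ^ k) • (dA^[k] a))
    (by simp [iterate_map_zero])

theorem ev_C (a : A) : ev ((Polynomial.C : A →+* G) a) = a := by
  rw [← Polynomial.monomial_zero_left, ev_monomial]; simp

theorem ev_N (p : G) : ev (N p) = 0 := by
  induction p using Polynomial.induction_on' with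
  | add p q hp hq => rw [map_add, map_add, hp, hq, add_zero]
  | monomial k a =>
    have : N (Polynomial.monomial k a) =
        Polynomial.monomial k (dA a) + Polynomial.monomial (k + 1) a := by
      rw [N_apply, Polynomial.X_mul_monomial]
      congr 1
      ext1 i
      rw [coeff_dxP, Polynomial.coeff_monomial, Polynomial.coeff_monomial]
      split_ifs <;> simp
    rw [this, map_add, ev_monomial, ev_monomial, Function.iterate_succ_apply, pow_succ]
    simp

theorem ev_DA (f : A) : ev (DA f) = delta f := by
  change (DA f).sum (fun k a => ((-1 : ℝ) ^ k) • (dA^[k] a)) = _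
  rw [delta, dx_fun, Polynomial.sum_def, finsum_eq_sum_of_support_subset (s := (DA f).support)]
  · refine Finset.sum_congr rfl fun k _ => ?_
    rw [DA_apply, coeff_DG]
  · intro k hk
    rw [Finset.mem_coe, Polynomial.mem_support_iff, DA_apply, coeff_DG]
    intro h
    apply hk
    simp [h, iterate_map_zero]

/-! ### Assembly -/

abbrev K := PowerSeries (PowerSeries A)

noncomputable def cc : ℕ → ℕ
  | 0 => 1
  | n + 1 => (2 * n + 1) * cc n

theorem cc_ne (n : ℕ) : cc n ≠ 0 := by
  induction n with
  | zero => simp [cc]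
  | succ n ih => simp [cc, ih]

noncomputable def SS (R : ℕ → G) : K :=
  PowerSeries.mk fun n => cc n • PowerSeries.mk fun i => (R n).coeff i

theorem coeff_SS (R : ℕ → G) (n i : ℕ) :
    PowerSeries.coeff i (PowerSeries.coeff n (SS R)) = (cc n : A) * (R n).coeff i := by
  rw [SS, PowerSeries.coeff_mk, map_nsmul, PowerSeries.coeff_mk, nsmul_eq_mul]

noncomputable def dK : K →+ K := psMap (psMap dA)

theorem coeff_dK (p : K) (n i : ℕ) : PowerSeries.coeff i (PowerSeries.coeff n (dK p)) =
    dA (PowerSeries.coeff i (PowerSeries.coeff n p)) := by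
  rw [dK, coeff_psMap, coeff_psMap]

noncomputable def uu : K := PowerSeries.C (PowerSeries.C (X 0))

noncomputable def eps : K :=
  PowerSeries.C (PowerSeries.C (C (1/4 : ℝ)) * (PowerSeries.X * PowerSeries.X))

theorem dA_nat (n : ℕ) (f : A) : dA ((n : A) * f) = (n : A) * dA f := by
  rw [← nsmul_eq_mul, map_nsmul, nsmul_eq_mul]

theorem dA_C (r : ℝ) : dA (C r) = 0 := by rw [← dx_eq', dx_C]

theorem dA_one : dA 1 = 0 := by rw [← dA_C 1, C_1]

theorem psMap_one_zero {R G : Type*} [CommRing R] [CommRing G] (f : R →+ G) (h : f 1 = 0) :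
    psMap f 1 = 0 := by
  have := psMap_C f 1
  rw [map_one, h, map_zero] at this
  exact this

theorem rec_K (R : ℕ → G) (h : IsGD R) :
    dK (SS R) = PowerSeries.X * (dK uu * SS R + 2 * uu * dK (SS R)
      + eps * dK (dK (dK (SS R)))) := by
  obtain ⟨h0, -, h2⟩ := h
  have du : dK uu = PowerSeries.C (PowerSeries.C (X 1)) := by
    rw [dK, uu, psMap_C, psMap_C, ← dx_eq', dx_X]
  have hw : (2 * uu : K) = PowerSeries.C (PowerSeries.C (C 2 * X 0)) := by
    rw [uu, map_mul, map_mul, map_ofNat, map_ofNat, map_ofNat]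
  rw [du, hw]
  ext1 n
  cases n with
  | zero =>
    ext1 i
    rw [coeff_dK, coeff_SS, h0, PowerSeries.coeff_zero_X_mul, map_zero, dA_nat,
      Polynomial.coeff_one]
    split_ifs <;> simp [dA_one]
  | succ n =>
    rw [PowerSeries.coeff_succ_X_mul]
    simp only [map_add, eps, PowerSeries.coeff_C_mul]
    ext1 i
    have := congrArg (Polynomial.coeff · i) (h2 n)
    have e3 : ∀ p : G, ((Polynomial.C (C (1/4 : ℝ)) * Polynomial.X ^ 2) * p).coeff i =
        PowerSeries.coeff i (PowerSeries.C (C (1/4 : ℝ)) * (PowerSeries.X * PowerSeries.X) *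
          (PowerSeries.mk fun j => p.coeff j : PowerSeries A)) := by
      intro p
      rw [mul_assoc, mul_assoc, mul_assoc, PowerSeries.coeff_C_mul, Polynomial.coeff_C_mul, pow_two,
        mul_assoc]
      rcases i with _ | _ | i
      · simp
      · rw [Polynomial.coeff_X_mul, PowerSeries.coeff_succ_X_mul]; simp
      · rw [Polynomial.coeff_X_mul, PowerSeries.coeff_succ_X_mul,
          Polynomial.coeff_X_mul, PowerSeries.coeff_succ_X_mul, PowerSeries.coeff_mk]
    have e4 : PowerSeries.coeff n (dK (dK (dK (SS R)))) =
        PowerSeries.C (cc n : A) * (PowerSeries.mk fun j => (dxP (dxP (dxP (R n)))).coeff j) := by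
      ext1 j
      rw [PowerSeries.coeff_C_mul, PowerSeries.coeff_mk]
      simp only [coeff_dK, coeff_SS, dA_nat, coeff_dxP]
    rw [e4, mul_left_comm]
    simp only [Polynomial.coeff_add, Polynomial.coeff_C_mul, e3, coeff_dxP] at this
    simp only [map_add, PowerSeries.coeff_C_mul, coeff_dK, coeff_SS, dA_nat, coeff_dxP]
    have hc : (cc (n + 1) : A) = C (2 * (n : ℝ) + 1) * (cc n : A) := by
      rw [cc]; push_cast; rw [map_add, map_mul, map_ofNat, map_natCast, map_one]
    rw [hc]
    linear_combination (cc n : A) * this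

theorem hdK (a b : K) : dK (a * b) = a * dK b + b * dK a := by
  have h1 : ∀ a b : A, dA (a * b) = (RingHom.id A) a * dA b + (RingHom.id A) b * dA a := dA_mul
  have := psMap_leib _ _ (psMap_leib _ _ h1) a b
  have hid : PowerSeries.map (RingHom.id A) = RingHom.id (PowerSeries A) := by ext; simp
  have hid2 : PowerSeries.map (RingHom.id (PowerSeries A)) = RingHom.id K := by ext; simp
  rw [hid, hid2] at this
  exact this

theorem dK_X : dK PowerSeries.X = 0 := psMap_X _ (psMap_one_zero _ dA_one)

theorem dK_eps : dK eps = 0 := by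
  rw [dK, eps, psMap_C]
  have h1 : ∀ a b : A, dA (a * b) = (RingHom.id A) a * dA b + (RingHom.id A) b * dA a := dA_mul
  rw [psMap_leib _ _ h1, psMap_leib _ _ h1, psMap_X _ dA_one, psMap_C, dA_C]
  simp

noncomputable def aug : K →+* PowerSeries (PowerSeries ℝ) :=
  PowerSeries.map (PowerSeries.map constantCoeff)

theorem coeff_aug (p : K) (n i : ℕ) : PowerSeries.coeff i (PowerSeries.coeff n (aug p)) =
    constantCoeff (PowerSeries.coeff i (PowerSeries.coeff n p)) := by
  rw [aug, PowerSeries.coeff_map, PowerSeries.coeff_map]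

theorem aug_dK (p : K) : aug (dK p) = 0 := by
  ext n i
  rw [coeff_aug, coeff_dK, const_dA]; simp

theorem eq_one_of (F : K) (h : dK F = 0) (h1 : aug F = 1) : F = 1 := by
  ext1 n
  ext1 i
  rw [ker_dA (PowerSeries.coeff i (PowerSeries.coeff n F)) (by rw [← coeff_dK, h]; simp),
    ← coeff_aug, h1]
  rw [PowerSeries.coeff_one, PowerSeries.coeff_one]
  split_ifs
  · rw [PowerSeries.coeff_one, PowerSeries.coeff_one]
    split_ifs <;> simp
  · simp

theorem aug_SS (R : ℕ → G) (h : IsGD R) : aug (SS R) = 1 := by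
  obtain ⟨h0, h1, -⟩ := h
  ext n i
  rw [coeff_aug, coeff_SS, map_mul]
  cases n with
  | zero =>
    rw [h0, Polynomial.coeff_one, PowerSeries.coeff_zero_one, PowerSeries.coeff_one]
    split_ifs <;> simp [cc]
  | succ n =>
    have : constantCoeff ((R (n + 1)).coeff i) = 0 := h1 (n + 1) (by omega) i
    rw [this, PowerSeries.coeff_one]; simp

theorem aug_uu : aug uu = 0 := by
  rw [aug, uu, PowerSeries.map_C, PowerSeries.map_C]; simp

theorem quad_K (R : ℕ → G) (h : IsGD R) :
    SS R * SS R - 2 * (uu * (PowerSeries.X * (SS R * SS R)))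
      - PowerSeries.X * (eps * (2 * (SS R * dK (dK (SS R))) - dK (SS R) * dK (SS R))) = 1 := by
  apply eq_one_of
  · exact abs_quad dK hdK _ _ _ _ dK_X dK_eps (rec_K R h)
  · simp only [map_sub, map_mul, aug_dK, aug_uu, aug_SS R h]
    simp

noncomputable def ιK : K →+* PowerSeries (PowerSeries G) :=
  PowerSeries.map (PowerSeries.map Polynomial.C)

theorem coeff_ιK (p : K) (n i : ℕ) : PowerSeries.coeff i (PowerSeries.coeff n (ιK p)) =
    Polynomial.C (PowerSeries.coeff i (PowerSeries.coeff n p)) := by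
  rw [ιK, PowerSeries.coeff_map, PowerSeries.coeff_map]

noncomputable def DK : K →+ PowerSeries (PowerSeries G) := psMap (psMap DA)

noncomputable def NK : PowerSeries (PowerSeries G) →+ PowerSeries (PowerSeries G) :=
  psMap (psMap N)

theorem DA_C (r : ℝ) : DA (C r) = 0 := by rw [DA_apply, derivation_C]

theorem DA_one : DA 1 = 0 := by rw [← DA_C 1, C_1]

theorem main_K (R : ℕ → G) (h : IsGD R) : ∃ Y,
    DK (SS R) - ιK (PowerSeries.X * (2 * theta (SS R) + SS R)) = NK Y := by
  obtain ⟨Q, hQ⟩ : ∃ Q, SS R * Q = 1 := by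
    have hc : PowerSeries.constantCoeff (SS R) = ((1 : (PowerSeries A)ˣ) : PowerSeries A) := by
      rw [← PowerSeries.coeff_zero_eq_constantCoeff_apply]
      ext1 i
      rw [coeff_SS, h.1, Polynomial.coeff_one, Units.val_one, PowerSeries.coeff_one]
      simp [cc]
    exact ⟨_, PowerSeries.mul_invOfUnit _ _ hc⟩
  have Du : DK uu = 1 := by
    rw [DK, uu, psMap_C, psMap_C, DA_apply, DG, mkDerivation_X]; simp
  have De : DK eps = 0 := by
    rw [DK, eps, psMap_C, psMap_leib _ _ DA_mul, psMap_leib _ _ DA_mul, psMap_X _ DA_one,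
      psMap_C, DA_C]
    simp
  have hDd : ∀ a, DK (dK a) = NK (DK a) := by
    intro a
    ext1 n
    ext1 i
    simp only [DK, NK, dK, coeff_psMap, DA_dA]
  have main := abs_main ιK dK theta DK NK hdK theta_leib
    (psMap_leib _ _ (psMap_leib _ _ DA_mul)) (psMap_leib2 _ _ _ (psMap_leib2 _ _ _ N_leib))
    (theta_psMap _) hDd (SS R) Q PowerSeries.X uu eps hQ dK_X dK_eps theta_X
    (theta_C _) (theta_C _) (psMap_X _ (psMap_one_zero _ DA_one)) De Du (quad_K R h)
  have hX : ιK PowerSeries.X = PowerSeries.X := PowerSeries.map_X _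
  have h2 : (2 : PowerSeries (PowerSeries G)) ≠ 0 := by
    intro h
    have := congrArg (fun p => PowerSeries.constantCoeff (PowerSeries.constantCoeff p)) h
    simp only [map_ofNat, map_zero] at this
    exact two_ne_zero this
  rw [hX] at main
  exact ⟨_, mul_left_cancel₀ PowerSeries.X_ne_zero (mul_left_cancel₀ h2 main)⟩

end GDProof

/-- `δ R_{n+1} = R_n` for every `n ≥ 0`. -/
theorem delta_gelfandDickey :
    ∀ R : ℕ → Polynomial (MvPolynomial ℕ ℝ), IsGD R →
      ∀ n : ℕ, deltaP (R (n + 1)) = R n := by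
  intro R h n
  obtain ⟨Y, hY⟩ := GDProof.main_K R h
  ext1 i
  rw [GDProof.coeff_deltaP]
  have e := congrArg (fun p => GDProof.ev (PowerSeries.coeff i (PowerSeries.coeff (n + 1) p))) hY
  simp only [map_sub, GDProof.coeff_ιK, GDProof.ev_C, GDProof.NK, GDProof.DK, GDProof.coeff_psMap,
    GDProof.ev_N, GDProof.ev_DA, GDProof.coeff_SS, PowerSeries.coeff_succ_X_mul] at e
  rw [← GDProof.ev_DA, ← nsmul_eq_mul, map_nsmul, map_nsmul, GDProof.ev_DA, two_mul] at e
  simp only [map_add, GDProof.coeff_theta, ← nsmul_eq_mul, map_nsmul, GDProof.coeff_SS] at e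
  simp only [nsmul_eq_mul, GDProof.coeff_SS, GDProof.cc] at e
  push_cast at e
  have hc : ((2 * n + 1) * GDProof.cc n : MvPolynomial ℕ ℝ) ≠ 0 := by
    have := GDProof.cc_ne (n + 1)
    rw [GDProof.cc] at this
    exact_mod_cast this
  apply mul_left_cancel₀ hc
  linear_combination e
end

section
/- For every n ≥ 0 there exists a unique element T_n ∈ A[λ] with zero constant term such that ∂_x T_n = u_1 · R_n; in particular T_0 = u_0, T_1 = u_0²/2, and T_2 = u_0³/6 + (λ²/24) u_1². -/
open MvPolynomial

/-- `T : ℕ → A[λ]` is the sequence of antiderivatives: each `T n` has zero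
constant term and `∂ₓ T_n = u₁ · R_n`. -/
def IsT (R T : ℕ → Polynomial (MvPolynomial ℕ ℝ)) : Prop :=
  ∀ n : ℕ, NoConst (T n) ∧ dxP (T n) = Polynomial.C (X 1) * R n

/-- The derivation agreeing with `dx`. -/
noncomputable def dD : Derivation ℝ (MvPolynomial ℕ ℝ) (MvPolynomial ℕ ℝ) :=
  mkDerivation ℝ (fun k => X (k + 1))

lemma dx_eq_sum (f : MvPolynomial ℕ ℝ) : dx f = ∑ k ∈ f.vars, X (k + 1) * pderiv k f := by
  unfold dx
  apply finsum_eq_sum_of_support_subset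
  intro k hk
  by_contra h
  apply hk
  have h' : k ∉ f.vars := by simpa using h
  simp [pderiv_eq_zero_of_notMem_vars h']

lemma dx_eq (f : MvPolynomial ℕ ℝ) : dx f = dD f := by
  rw [dx_eq_sum]
  have key : ∀ s : Finset ℕ, ∀ g : MvPolynomial ℕ ℝ,
      (∑ k ∈ s, (X (k + 1) : MvPolynomial ℕ ℝ) • (pderiv (R := ℝ) k)) g
        = ∑ k ∈ s, X (k + 1) * pderiv k g := by
    intro s g
    induction s using Finset.induction_on with
    | empty => simp
    | insert a s ha ih => rw [Finset.sum_insert ha, Finset.sum_insert ha, Derivation.add_apply, ih]; simp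
  rw [← key]
  apply derivation_eq_of_forall_mem_vars
  intro i hi
  rw [key, dD, mkDerivation_X, Finset.sum_eq_single i]
  · simp
  · intro b _ hb
    rw [pderiv_X_of_ne (Ne.symm hb), mul_zero]
  · intro h; exact absurd hi h

lemma coeff_zero_dx (f : MvPolynomial ℕ ℝ) : coeff 0 (dx f) = 0 := by
  rw [dx_eq_sum, ← constantCoeff_eq, map_sum]
  simp

lemma pderiv_dD (k : ℕ) (f : MvPolynomial ℕ ℝ) :
    pderiv (k + 1) (dD f) = dD (pderiv (k + 1) f) + pderiv k f := by
  have h : ⁅pderiv (R := ℝ) (k + 1), dD⁆ = pderiv (R := ℝ) k := by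
    apply derivation_ext
    intro i
    rw [Derivation.commutator_apply]
    simp only [dD, mkDerivation_X, pderiv_X, Pi.single_apply]
    by_cases h1 : i = k
    · subst h1; simp
    · by_cases h2 : i = k + 1
      · subst h2; simp
      · simp [h1, h2]
  have h2 := congrArg (fun d => d f) h
  simp only [Derivation.commutator_apply] at h2
  rw [← h2]; ring

lemma dx_ker (f : MvPolynomial ℕ ℝ) (h : dx f = 0) (h0 : coeff 0 f = 0) : f = 0 := by
  rw [dx_eq] at h
  have step : ∀ k, pderiv (k + 1) f = 0 → pderiv k f = 0 := by
    intro k hk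
    have := pderiv_dD k f
    simpa [h, hk] using this.symm
  have big : ∀ k, f.vars.sup id < k → pderiv k f = 0 := by
    intro k hk
    apply pderiv_eq_zero_of_notMem_vars
    intro hm
    exact absurd (Finset.le_sup (f := id) hm) (by simpa using hk)
  have down : ∀ n k, pderiv (k + n) f = 0 → pderiv k f = 0 := by
    intro n
    induction n with
    | zero => intro k hk; exact hk
    | succ n ih => intro k hk; exact ih k (step _ hk)
  have all : ∀ k, pderiv k f = 0 := fun k =>
    down (f.vars.sup id + 1) k (big _ (by omega))
  ext m
  rw [coeff_zero]
  by_cases hm : m = 0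
  · rw [hm, h0]
  · obtain ⟨i, hi⟩ := Finsupp.ne_iff.1 hm
    have hc := coeff_pderiv (i := i) f (m - Finsupp.single i 1)
    rw [all i, coeff_zero, tsub_add_cancel_of_le] at hc
    · rcases mul_eq_zero.1 hc.symm with h | h
      · exact h
      · exact absurd h (by positivity)
    · rw [Finsupp.single_le_iff]
      exact Nat.one_le_iff_ne_zero.2 hi

lemma dx_zero : dx 0 = 0 := by rw [dx_eq, map_zero]

lemma coeff_dxP (p : Polynomial (MvPolynomial ℕ ℝ)) (i : ℕ) :
    (dxP p).coeff i = dx (p.coeff i) := by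
  unfold dxP Polynomial.sum
  rw [Polynomial.finsetSum_coeff]
  simp only [Polynomial.coeff_C_mul_X_pow]
  rw [Finset.sum_ite_eq]
  split_ifs with h
  · rfl
  · rw [Polynomial.notMem_support_iff.1 h, dx_zero]

lemma dxP_add (p q : Polynomial (MvPolynomial ℕ ℝ)) : dxP (p + q) = dxP p + dxP q := by
  ext1 i; simp [coeff_dxP, dx_eq]

lemma dxP_sub (p q : Polynomial (MvPolynomial ℕ ℝ)) : dxP (p - q) = dxP p - dxP q := by
  ext1 i; simp [coeff_dxP, dx_eq]

lemma dxP_C_mul (a : MvPolynomial ℕ ℝ) (p : Polynomial (MvPolynomial ℕ ℝ)) :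
    dxP (Polynomial.C a * p) = Polynomial.C a * dxP p + Polynomial.C (dD a) * p := by
  ext1 i
  simp only [coeff_dxP, dx_eq, Polynomial.coeff_C_mul, Polynomial.coeff_add, Derivation.leibniz,
    smul_eq_mul]
  ring

lemma dxP_mul_X_pow (p : Polynomial (MvPolynomial ℕ ℝ)) (n : ℕ) :
    dxP (p * Polynomial.X ^ n) = dxP p * Polynomial.X ^ n := by
  ext1 i
  simp only [coeff_dxP, Polynomial.coeff_mul_X_pow']
  split_ifs
  · rfl
  · exact dx_zero

lemma dxP_C (a : MvPolynomial ℕ ℝ) : dxP (Polynomial.C a) = Polynomial.C (dD a) := by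
  ext1 i
  simp only [coeff_dxP, Polynomial.coeff_C, dx_eq]
  split_ifs <;> simp

lemma dD_X (k : ℕ) : dD (X k) = X (k + 1) := by rw [dD, mkDerivation_X]

lemma dD_C (a : ℝ) : dD (C a) = 0 := by
  rw [← algebraMap_eq]; exact dD.map_algebraMap a

lemma dxP_inj {p q : Polynomial (MvPolynomial ℕ ℝ)} (hp : NoConst p) (hq : NoConst q)
    (h : dxP p = dxP q) : p = q := by
  rw [← sub_eq_zero]
  ext1 i
  rw [Polynomial.coeff_zero]
  apply dx_ker
  · rw [← coeff_dxP, dxP_sub, h, sub_self, Polynomial.coeff_zero]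
  · rw [Polynomial.coeff_sub, coeff_sub, hp i, hq i, sub_zero]

lemma noConst_add {p q : Polynomial (MvPolynomial ℕ ℝ)} (hp : NoConst p) (hq : NoConst q) :
    NoConst (p + q) := fun i => by rw [Polynomial.coeff_add, coeff_add, hp i, hq i, add_zero]

lemma noConst_sub {p q : Polynomial (MvPolynomial ℕ ℝ)} (hp : NoConst p) (hq : NoConst q) :
    NoConst (p - q) := fun i => by rw [Polynomial.coeff_sub, coeff_sub, hp i, hq i, sub_zero]

lemma noConst_C_mul (a : MvPolynomial ℕ ℝ) {p : Polynomial (MvPolynomial ℕ ℝ)} (hp : NoConst p) :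
    NoConst (Polynomial.C a * p) := fun i => by
  have := hp i
  rw [← constantCoeff_eq] at this ⊢
  rw [Polynomial.coeff_C_mul, map_mul, this, mul_zero]

lemma noConst_C_mul' {a : MvPolynomial ℕ ℝ} (ha : coeff 0 a = 0)
    (p : Polynomial (MvPolynomial ℕ ℝ)) :
    NoConst (Polynomial.C a * p) := fun i => by
  rw [← constantCoeff_eq] at ha ⊢
  rw [Polynomial.coeff_C_mul, map_mul, ha, zero_mul]

lemma noConst_C {a : MvPolynomial ℕ ℝ} (ha : coeff 0 a = 0) :
    NoConst (Polynomial.C a) := by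
  simpa using noConst_C_mul' ha 1

lemma noConst_mul_X_pow {p : Polynomial (MvPolynomial ℕ ℝ)} (hp : NoConst p) (n : ℕ) :
    NoConst (p * Polynomial.X ^ n) := fun i => by
  rw [Polynomial.coeff_mul_X_pow']
  split_ifs
  · exact hp _
  · rfl

lemma noConst_dxP (p : Polynomial (MvPolynomial ℕ ℝ)) : NoConst (dxP p) := fun i => by
  rw [coeff_dxP, coeff_zero_dx]

lemma dxP_one : dxP 1 = 0 := by
  rw [← Polynomial.C_1, dxP_C]; simp

lemma CC_cancel {a : ℝ} (ha : a ≠ 0) {p q : Polynomial (MvPolynomial ℕ ℝ)}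
    (h : Polynomial.C (MvPolynomial.C a) * p = Polynomial.C (MvPolynomial.C a) * q) : p = q := by
  apply mul_left_cancel₀ _ h
  simpa using ha

lemma CC_mul (a b : ℝ) : (Polynomial.C (MvPolynomial.C a) : Polynomial (MvPolynomial ℕ ℝ)) *
    Polynomial.C (MvPolynomial.C b) = Polynomial.C (MvPolynomial.C (a * b)) := by simp

lemma coeff_zero_mul {a : MvPolynomial ℕ ℝ} (b : MvPolynomial ℕ ℝ) (ha : coeff 0 a = 0) :
    coeff 0 (b * a) = 0 := by
  rw [← constantCoeff_eq] at ha ⊢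
  rw [map_mul, ha, mul_zero]

lemma R_one {R : ℕ → Polynomial (MvPolynomial ℕ ℝ)} (h : IsGD R) :
    R 1 = Polynomial.C (X 0) := by
  obtain ⟨h0, hn, hr⟩ := h
  apply dxP_inj (hn 1 le_rfl) (noConst_C (by simp))
  have := hr 0
  rw [h0, dxP_one, ← Polynomial.C_0, dxP_C, map_zero, dxP_C, map_zero] at this
  rw [dxP_C, dD_X]
  simpa using this

lemma R_two {R : ℕ → Polynomial (MvPolynomial ℕ ℝ)} (h : IsGD R) :
    R 2 = Polynomial.C (MvPolynomial.C (1 / 2 : ℝ) * X 0 ^ 2)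
      + Polynomial.C (MvPolynomial.C (1 / 12 : ℝ) * X 2) * Polynomial.X ^ 2 := by
  have h1 := R_one h
  obtain ⟨h0, hn, hr⟩ := h
  apply dxP_inj (hn 2 (by norm_num))
  · exact noConst_add (noConst_C (coeff_zero_mul _ (by simp [← constantCoeff_eq])))
      (noConst_mul_X_pow (noConst_C (coeff_zero_mul _ (by simp))) 2)
  apply CC_cancel (a := 2 * ((1 : ℕ) : ℝ) + 1) (by norm_num)
  rw [hr 1, h1]
  simp only [dxP_add, dxP_mul_X_pow, dxP_C, dD_X, Derivation.leibniz, Derivation.leibniz_pow, dD_C,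
    smul_eq_mul, mul_zero, add_zero]
  have e1 : (MvPolynomial.C (2 * ((1 : ℕ) : ℝ) + 1) : MvPolynomial ℕ ℝ) * C (1 / 2) * 2 = 3 := by
    rw [← map_ofNat (C : ℝ →+* MvPolynomial ℕ ℝ) 2, ← map_ofNat (C : ℝ →+* MvPolynomial ℕ ℝ) 3,
      ← C_mul, ← C_mul]; norm_num
  have e2 : (MvPolynomial.C (2 * ((1 : ℕ) : ℝ) + 1) : MvPolynomial ℕ ℝ) * C (1 / 12) = C (1 / 4) := by
    rw [← C_mul]; norm_num
  have e3 : (C 2 : MvPolynomial ℕ ℝ) = 2 := map_ofNat _ 2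
  rw [mul_add, ← mul_assoc, ← Polynomial.C_mul, ← Polynomial.C_mul, ← Polynomial.C_mul,
    ← Polynomial.C_mul, ← Polynomial.C_add, mul_right_comm (Polynomial.C _) (Polynomial.X ^ 2) _, ← Polynomial.C_mul, ← mul_assoc (C _) (C _) (X _), e2, e3]
  congr 2
  simp only [nsmul_eq_mul]
  push_cast at e1 ⊢
  linear_combination (-(X 0 * X 1 : MvPolynomial ℕ ℝ)) * e1

lemma noConst_T {R : ℕ → Polynomial (MvPolynomial ℕ ℝ)} (h : IsGD R) (n : ℕ) :
    NoConst (Polynomial.C (MvPolynomial.C 2 * X 0) * R n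
      + Polynomial.C (MvPolynomial.C (1 / 4 : ℝ)) * dxP (dxP (R n)) * Polynomial.X ^ 2
      - Polynomial.C (MvPolynomial.C (2 * (n : ℝ) + 1)) * R (n + 1)) := by
  refine noConst_sub (noConst_add (noConst_C_mul' (coeff_zero_mul _ (by simp)) _)
    (noConst_mul_X_pow (noConst_C_mul _ (noConst_dxP _)) _)) (noConst_C_mul _ (h.2.1 _ (by omega)))

lemma dxP_T {R : ℕ → Polynomial (MvPolynomial ℕ ℝ)} (h : IsGD R) (n : ℕ) :
    dxP (Polynomial.C (MvPolynomial.C 2 * X 0) * R n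
      + Polynomial.C (MvPolynomial.C (1 / 4 : ℝ)) * dxP (dxP (R n)) * Polynomial.X ^ 2
      - Polynomial.C (MvPolynomial.C (2 * (n : ℝ) + 1)) * R (n + 1))
      = Polynomial.C (X 1) * R n := by
  have hr := h.2.2 n
  have e3 : (C 2 : MvPolynomial ℕ ℝ) = 2 := map_ofNat _ 2
  simp only [dxP_add, dxP_sub, dxP_mul_X_pow, dxP_C_mul, dD_X, dD_C, Derivation.leibniz,
    smul_eq_mul, mul_zero, add_zero, map_zero, zero_mul]
  rw [e3] at *
  simp only [map_mul, map_ofNat] at *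
  linear_combination (-1 : Polynomial (MvPolynomial ℕ ℝ)) * hr

/-- for every `n` there is a unique `T_n ∈ A[λ]` with zero constant
term such that `∂ₓ T_n = u₁ · R_n`; in particular `T 0 = u₀`, `T 1 = u₀²/2`, and
`T 2 = u₀³/6 + (λ²/24) u₁²`. -/
theorem T_exists_unique :
    ∀ R : ℕ → Polynomial (MvPolynomial ℕ ℝ), IsGD R →
      ∃ T : ℕ → Polynomial (MvPolynomial ℕ ℝ), IsT R T ∧
        T 0 = Polynomial.C (X 0) ∧
        T 1 = Polynomial.C (MvPolynomial.C (1 / 2 : ℝ) * X 0 ^ 2) ∧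
        T 2 = Polynomial.C (MvPolynomial.C (1 / 6 : ℝ) * X 0 ^ 3)
              + Polynomial.C (MvPolynomial.C (1 / 24 : ℝ) * X 1 ^ 2) * Polynomial.X ^ 2 ∧
        ∀ T' : ℕ → Polynomial (MvPolynomial ℕ ℝ), IsT R T' → T' = T := by
  intro R hR
  refine ⟨fun n => Polynomial.C (MvPolynomial.C 2 * X 0) * R n
      + Polynomial.C (MvPolynomial.C (1 / 4 : ℝ)) * dxP (dxP (R n)) * Polynomial.X ^ 2
      - Polynomial.C (MvPolynomial.C (2 * (n : ℝ) + 1)) * R (n + 1),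
    fun n => ⟨noConst_T hR n, dxP_T hR n⟩, ?_, ?_, ?_, ?_⟩
  · apply dxP_inj (noConst_T hR 0) (noConst_C (by simp))
    rw [dxP_T hR 0, hR.1, dxP_C, dD_X, mul_one]
  · apply dxP_inj (noConst_T hR 1)
      (noConst_C (coeff_zero_mul _ (by simp [← constantCoeff_eq])))
    rw [dxP_T hR 1, R_one hR, dxP_C, ← Polynomial.C_mul]
    congr 1
    have e1 : (C (1 / 2) : MvPolynomial ℕ ℝ) * 2 = 1 := by
      rw [← map_ofNat (C : ℝ →+* MvPolynomial ℕ ℝ) 2, ← C_mul]; norm_num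
    simp only [dD_X, Derivation.leibniz, Derivation.leibniz_pow, dD_C, smul_eq_mul, mul_zero,
      add_zero, nsmul_eq_mul]
    push_cast
    linear_combination (-(X 0 * X 1 : MvPolynomial ℕ ℝ)) * e1
  · apply dxP_inj (noConst_T hR 2)
    · exact noConst_add (noConst_C (coeff_zero_mul _ (by simp [← constantCoeff_eq])))
        (noConst_mul_X_pow (noConst_C (coeff_zero_mul _ (by simp [← constantCoeff_eq]))) 2)
    rw [dxP_T hR 2, R_two hR, dxP_add, dxP_mul_X_pow, dxP_C, dxP_C, mul_add, ← mul_assoc,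
      ← Polynomial.C_mul, ← Polynomial.C_mul]
    have e1 : (C (1 / 6) : MvPolynomial ℕ ℝ) * 3 = C (1 / 2) := by
      rw [← map_ofNat (C : ℝ →+* MvPolynomial ℕ ℝ) 3, ← C_mul]; norm_num
    have e2 : (C (1 / 24) : MvPolynomial ℕ ℝ) * 2 = C (1 / 12) := by
      rw [← map_ofNat (C : ℝ →+* MvPolynomial ℕ ℝ) 2, ← C_mul]; norm_num
    simp only [dD_X, Derivation.leibniz, Derivation.leibniz_pow, dD_C, smul_eq_mul, mul_zero,
      add_zero, nsmul_eq_mul]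
    congr 2
    · push_cast
      linear_combination (-(X 0 ^ 2 * X 1 : MvPolynomial ℕ ℝ)) * e1
    · congr 1
      push_cast
      linear_combination (-(X 1 * X 2 : MvPolynomial ℕ ℝ)) * e2
  · intro T' hT'
    funext n
    exact dxP_inj (hT' n).1 (noConst_T hR n) ((hT' n).2.trans (dxP_T hR n).symm)
end

section
/- For every n ≥ 0, δ(u_0 · R_n) = (n+1) R_n − (λ/2) ∂R_n/∂λ, where ∂/∂λ is formal differentiation with respect to the indeterminate λ. -/
open MvPolynomial

abbrev AA := MvPolynomial ℕ ℝ

noncomputable def dd : Derivation ℝ AA AA := mkDerivation ℝ (fun k => X (k+1))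
noncomputable def EE : Derivation ℝ AA AA := mkDerivation ℝ (fun k => X k)
noncomputable def DD : Derivation ℝ AA (Polynomial AA) :=
  mkDerivation ℝ (fun k => Polynomial.X ^ k)

noncomputable def muv (v : ℕ → AA) : Polynomial AA →ₗ[AA] AA :=
  Polynomial.lsum (fun k => LinearMap.mulLeft AA (v k))

lemma muv_DD (v : ℕ → AA) (f : AA) : muv v (DD f) = mkDerivation ℝ v f := by
  have : (muv v).compDer DD = mkDerivation ℝ v := by
    apply MvPolynomial.derivation_ext
    intro i
    simp [DD, muv, Polynomial.lsum_apply, ← Polynomial.monomial_one_right_eq_X_pow,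
      Polynomial.sum_monomial_index]
  rw [← this]; rfl

lemma coeff_DD (f : AA) (k : ℕ) : (DD f).coeff k = pderiv k f := by
  have : (Polynomial.lcoeff AA k).compDer DD = pderiv k := by
    apply MvPolynomial.derivation_ext
    intro i
    simp [DD, Polynomial.coeff_X_pow, pderiv_X, Pi.single_apply, eq_comm]
  rw [← this]; rfl

lemma finsum_eq_psum {M : Type*} [AddCommMonoid M] (w : Polynomial AA) (F : ℕ → AA → M)
    (hF : ∀ k, F k 0 = 0) : ∑ᶠ k, F k (w.coeff k) = w.sum F := by
  rw [Polynomial.sum_def]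
  apply finsum_eq_sum_of_support_subset
  intro k hk
  simp only [Function.mem_support] at hk
  simp only [Finset.mem_coe, Polynomial.mem_support_iff]
  intro h
  rw [h, hF] at hk
  exact hk rfl

lemma dx_eq_s11 (f : AA) : dx f = dd f := by
  unfold dx dd
  rw [← muv_DD, muv, Polynomial.lsum_apply]
  simp_rw [← coeff_DD]
  exact finsum_eq_psum (DD f) (fun k a => X (k+1) * a) (by simp)

lemma dx_fun : dx = dd := funext dx_eq_s11

noncomputable def Psi : Polynomial AA →ₗ[ℝ] AA :=
  Polynomial.lsum (fun k => ((-1 : ℝ) ^ k) • (dd.toLinearMap ^ k))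

lemma delta_eq (f : AA) : delta f = Psi (DD f) := by
  unfold delta Psi
  rw [Polynomial.lsum_apply]
  simp_rw [← coeff_DD, dx_fun]
  rw [finsum_eq_psum (DD f) (fun k a => ((-1 : ℝ) ^ k) • (dd^[k] a))]
  · simp only [LinearMap.smul_apply, Module.End.pow_apply]
    rfl
  · intro k
    have : dd^[k] 0 = (dd.toLinearMap ^ k) 0 := by rw [Module.End.pow_apply]; rfl
    rw [this]; simp

lemma Psi_monomial (k : ℕ) (a : AA) :
    Psi (Polynomial.monomial k a) = ((-1 : ℝ) ^ k) • ((dd.toLinearMap ^ k) a) := by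
  rw [Psi, Polynomial.lsum_apply, Polynomial.sum_monomial_index] <;> simp

/-- coefficientwise extension of a linear map -/
noncomputable def cw (L : AA →ₗ[ℝ] AA) : Polynomial AA →ₗ[ℝ] Polynomial AA :=
  Polynomial.lsum (fun k => (Polynomial.monomial k).restrictScalars ℝ ∘ₗ L)

lemma cw_monomial (L : AA →ₗ[ℝ] AA) (k : ℕ) (a : AA) :
    cw L (Polynomial.monomial k a) = Polynomial.monomial k (L a) := by
  rw [cw, Polynomial.lsum_apply, Polynomial.sum_monomial_index] <;> simp

lemma coeff_cw (L : AA →ₗ[ℝ] AA) (p : Polynomial AA) (k : ℕ) :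
    (cw L p).coeff k = L (p.coeff k) := by
  induction p using Polynomial.induction_on' with
  | add p q hp hq => simp [hp, hq]
  | monomial n a =>
    rw [cw_monomial, Polynomial.coeff_monomial, Polynomial.coeff_monomial]
    split_ifs <;> simp

noncomputable def nab : Polynomial AA →ₗ[ℝ] Polynomial AA :=
  cw dd.toLinearMap + LinearMap.mulLeft ℝ Polynomial.X

lemma Psi_nab (w : Polynomial AA) : Psi (nab w) = 0 := by
  induction w using Polynomial.induction_on' with
  | add p q hp hq => simp [hp, hq]
  | monomial n a =>
    simp only [nab, LinearMap.add_apply, cw_monomial, LinearMap.mulLeft_apply,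
      Polynomial.X_mul_monomial, map_add, Psi_monomial]
    rw [pow_succ (-1 : ℝ), pow_succ dd.toLinearMap]
    simp

lemma Psi_C (a : AA) : Psi (Polynomial.C a) = a := by
  rw [← Polynomial.monomial_zero_left, Psi_monomial]; simp

lemma nab_C_mul (a : AA) (w : Polynomial AA) :
    nab (Polynomial.C a * w) = Polynomial.C (dd a) * w + Polynomial.C a * nab w := by
  ext1 k
  cases k <;> simp [nab, coeff_cw, Polynomial.coeff_X_mul, mul_add] <;> ring

lemma pderiv_dd_zero (f : AA) : pderiv 0 (dd f) = dd (pderiv 0 f) := by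
  have : ⁅(pderiv 0 : Derivation ℝ AA AA), dd⁆ = 0 := by
    apply MvPolynomial.derivation_ext
    intro i
    by_cases h : i = 0 <;>
    simp [dd, Derivation.commutator_apply, pderiv_X, h]
  have := congrArg (fun D => D f) this
  simpa [Derivation.commutator_apply, sub_eq_zero] using this

lemma pderiv_dd_succ (k : ℕ) (f : AA) :
    pderiv (k+1) (dd f) = dd (pderiv (k+1) f) + pderiv k f := by
  have : ⁅(pderiv (k+1) : Derivation ℝ AA AA), dd⁆ = pderiv k := by
    apply MvPolynomial.derivation_ext
    intro i
    by_cases h : i = k + 1 <;> by_cases h' : i = k <;>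
    simp [dd, Derivation.commutator_apply, pderiv_X, h, h'] 
  have := congrArg (fun D => D f) this
  rw [← this]
  simp [Derivation.commutator_apply]

lemma DD_dd (f : AA) : DD (dd f) = nab (DD f) := by
  ext1 k
  cases k with
  | zero => simp [nab, coeff_cw, coeff_DD, pderiv_dd_zero]
  | succ k => simp [nab, coeff_cw, coeff_DD, pderiv_dd_succ, Polynomial.coeff_X_mul]

lemma EE_dd (f : AA) : EE (dd f) = dd (EE f) := by
  have : ⁅EE, dd⁆ = 0 := by
    apply MvPolynomial.derivation_ext
    intro i
    simp [EE, dd, Derivation.commutator_apply]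
  have := congrArg (fun D => D f) this
  simpa [Derivation.commutator_apply, sub_eq_zero] using this

lemma pderiv_EE (k : ℕ) (f : AA) : pderiv k (EE f) = EE (pderiv k f) + pderiv k f := by
  have : ⁅(pderiv k : Derivation ℝ AA AA), EE⁆ = pderiv k := by
    apply MvPolynomial.derivation_ext
    intro i
    by_cases h : i = k <;>
    simp [EE, Derivation.commutator_apply, pderiv_X, h]
  have := congrArg (fun D => D f) this
  simp only [Derivation.commutator_apply] at this
  rw [← sub_eq_iff_eq_add']
  exact this

lemma DD_EE (f : AA) : DD (EE f) = cw EE.toLinearMap (DD f) + DD f := by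
  ext1 k
  simp [coeff_cw, coeff_DD, pderiv_EE]

lemma EE_pow (k : ℕ) (a : AA) :
    (dd.toLinearMap ^ k) (EE a) = EE ((dd.toLinearMap ^ k) a) := by
  induction k generalizing a with
  | zero => simp
  | succ k ih => simp [pow_succ, ← EE_dd, ih]

lemma Psi_EE (w : Polynomial AA) : Psi (cw EE.toLinearMap w) = EE (Psi w) := by
  induction w using Polynomial.induction_on' with
  | add p q hp hq => simp [hp, hq]
  | monomial n a =>
    simp [cw_monomial, Psi_monomial, EE_pow]

lemma X0_pow (k : ℕ) (j : ℕ) (a : AA) : ∃ b, X j * (((-1 : ℝ) ^ k) • ((dd.toLinearMap ^ k) a))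
    = X (j + k) * a + dd b := by
  induction k generalizing j with
  | zero => exact ⟨0, by simp⟩
  | succ k ih =>
    obtain ⟨b, hb⟩ := ih (j+1)
    refine ⟨b - X j * (((-1 : ℝ) ^ k) • ((dd.toLinearMap ^ k) a)), ?_⟩
    have h : dd (X j) = X (j+1) := by simp [dd]
    rw [map_sub, Derivation.leibniz, h, smul_eq_mul, smul_eq_mul, mul_comm _ (X (j+1)), hb,
      pow_succ' (-1 : ℝ), pow_succ' dd.toLinearMap]
    have e : j + 1 + k = j + (k + 1) := by ring
    rw [e]
    simp
    abel

lemma X0_Psi (w : Polynomial AA) : ∃ b, X 0 * Psi w = muv (fun k => X k) w + dd b := by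
  induction w using Polynomial.induction_on' with
  | add p q hp hq =>
    obtain ⟨b, hb⟩ := hp
    obtain ⟨c, hc⟩ := hq
    exact ⟨b + c, by rw [map_add, mul_add, hb, hc, map_add, map_add]; ring⟩
  | monomial n a =>
    obtain ⟨b, hb⟩ := X0_pow n 0 a
    refine ⟨b, ?_⟩
    rw [Psi_monomial, hb, muv, Polynomial.lsum_apply, Polynomial.sum_monomial_index] <;> simp

lemma Psi_DD_X0 (g : AA) :
    Psi (DD (X 0 * Psi (DD g))) = EE (Psi (DD g)) + Psi (DD g) := by
  obtain ⟨b, hb⟩ := X0_Psi (DD g)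
  rw [hb, muv_DD, map_add, map_add, DD_dd, Psi_nab]
  change Psi (DD (EE g)) + 0 = _
  rw [DD_EE, map_add, Psi_EE, add_zero]

lemma ker_dd (f : AA) (h : dd f = 0) : f = C (coeff 0 f) := by
  have key : ∀ k, pderiv k f = 0 := by
    by_contra hne
    push Not at hne
    obtain ⟨k, hk⟩ := hne
    have hmem : k ∈ (DD f).support := by
      rw [Polynomial.mem_support_iff, coeff_DD]; exact hk
    have h0 : DD f ≠ 0 := by rintro h; simp [h] at hmem
    have h1 := pderiv_dd_succ (DD f).natDegree f
    rw [h, ← coeff_DD f (_ + 1), ← coeff_DD f, Polynomial.coeff_natDegree_succ_eq_zero] at h1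
    simp at h1
    exact h0 (Polynomial.leadingCoeff_eq_zero.1 h1.symm)
  ext m
  rw [coeff_C]
  split_ifs with hm
  · rw [hm]
  · obtain ⟨i, hi⟩ : ∃ i, m i ≠ 0 := by
      by_contra hc
      push Not at hc
      exact hm (by ext i; simp [hc i])
    have h2 := coeff_pderiv (i := i) f (m - Finsupp.single i 1)
    rw [key i, tsub_add_cancel_of_le (by simpa [Finsupp.single_le_iff, Nat.one_le_iff_ne_zero] using hi)] at h2
    rw [coeff_zero] at h2
    rcases mul_eq_zero.1 h2.symm with h3 | h3
    · exact h3
    · exfalso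
      norm_cast at h3

lemma cc_mk (v : ℕ → AA) (hv : ∀ k, constantCoeff (v k) = 0) (f : AA) :
    constantCoeff (mkDerivation ℝ v f) = 0 := by
  rw [← muv_DD, muv, Polynomial.lsum_apply, Polynomial.sum_def, map_sum]
  apply Finset.sum_eq_zero
  intro k _
  simp [hv]

lemma cc_dd (f : AA) : constantCoeff (dd f) = 0 := cc_mk _ (by simp) f
lemma cc_EE (f : AA) : constantCoeff (EE f) = 0 := cc_mk _ (by simp) f

/-- Coefficientwise extension to power series in an auxiliary variable `t`. -/
noncomputable def tw {R R' : Type*} [Semiring R] [Semiring R'] (φ : R →+ R') :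
    PowerSeries R →+ PowerSeries R' where
  toFun f := PowerSeries.mk fun n => φ (PowerSeries.coeff n f)
  map_zero' := by ext; simp
  map_add' f g := by ext; simp

lemma coeff_tw {R R' : Type*} [Semiring R] [Semiring R'] (φ : R →+ R') (f : PowerSeries R)
    (n : ℕ) : PowerSeries.coeff n (tw φ f) = φ (PowerSeries.coeff n f) := by
  simp [tw]

lemma tw_mul {R R₁ R₂ : Type*} [Semiring R] [Semiring R₁] [Semiring R₂]
    (i : R →+ R₁) (φ : R₁ →+ R₂) (j ψ : R →+ R₂) (χ k : R₁ →+ R₂)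
    (h : ∀ a b, φ (i a * b) = j a * χ b + ψ a * k b) (f : PowerSeries R) (g : PowerSeries R₁) :
    tw φ (tw i f * g) = tw j f * tw χ g + tw ψ f * tw k g := by
  ext n
  simp only [coeff_tw, PowerSeries.coeff_mul, map_add, map_sum, h, Finset.sum_add_distrib]

noncomputable def tdd : PowerSeries AA →+ PowerSeries AA := tw dd.toLinearMap.toAddMonoidHom
noncomputable def tDD : PowerSeries AA →+ PowerSeries (Polynomial AA) :=
  tw DD.toLinearMap.toAddMonoidHom
noncomputable def tnab : PowerSeries (Polynomial AA) →+ PowerSeries (Polynomial AA) :=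
  tw nab.toAddMonoidHom
noncomputable def iot : PowerSeries AA →+* PowerSeries (Polynomial AA) :=
  PowerSeries.map Polynomial.C

lemma tw_id {R : Type*} [Semiring R] (f : PowerSeries R) : tw (AddMonoidHom.id R) f = f := by
  ext n; simp [coeff_tw]

lemma tw_C (f : PowerSeries AA) :
    tw (Polynomial.C : AA →+* Polynomial AA).toAddMonoidHom f = iot f := by
  ext1 n; simp [coeff_tw, iot]

lemma tdd_mul (f g : PowerSeries AA) : tdd (f * g) = f * tdd g + tdd f * g := by
  have := tw_mul (AddMonoidHom.id AA) dd.toLinearMap.toAddMonoidHom (AddMonoidHom.id AA)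
    dd.toLinearMap.toAddMonoidHom dd.toLinearMap.toAddMonoidHom (AddMonoidHom.id AA)
    (by intro a b; simp [mul_comm]) f g
  simp only [tw_id] at this
  exact this

lemma tDD_mul (f g : PowerSeries AA) : tDD (f * g) = iot f * tDD g + tDD f * iot g := by
  have := tw_mul (AddMonoidHom.id AA) DD.toLinearMap.toAddMonoidHom
    (Polynomial.C : AA →+* Polynomial AA).toAddMonoidHom
    DD.toLinearMap.toAddMonoidHom DD.toLinearMap.toAddMonoidHom
    (Polynomial.C : AA →+* Polynomial AA).toAddMonoidHom
    (by intro a b; simp [mul_comm, Polynomial.smul_eq_C_mul]) f g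
  simp only [tw_id, tw_C] at this
  exact this

lemma tnab_mul (f : PowerSeries AA) (w : PowerSeries (Polynomial AA)) :
    tnab (iot f * w) = iot f * tnab w + iot (tdd f) * w := by
  have := tw_mul (Polynomial.C : AA →+* Polynomial AA).toAddMonoidHom nab.toAddMonoidHom
    (Polynomial.C : AA →+* Polynomial AA).toAddMonoidHom
    ((Polynomial.C : AA →+* Polynomial AA).toAddMonoidHom.comp dd.toLinearMap.toAddMonoidHom)
    nab.toAddMonoidHom (AddMonoidHom.id _)
    (by intro a b; simp [nab_C_mul, add_comm]) f w
  simp only [tw_id, tw_C] at this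
  rw [tnab, this]
  have e : tw ((Polynomial.C : AA →+* Polynomial AA).toAddMonoidHom.comp
      dd.toLinearMap.toAddMonoidHom) f = iot (tdd f) := by
    ext1 n; simp [coeff_tw, iot, tdd]
  rw [e]

lemma tDD_tdd (f : PowerSeries AA) : tDD (tdd f) = tnab (tDD f) := by
  ext1 n; simp [coeff_tw, tDD, tdd, tnab, DD_dd]

lemma tdd_X : tdd PowerSeries.X = 0 := by
  ext1 n
  simp only [tdd, coeff_tw, PowerSeries.coeff_X]
  split_ifs <;> simp

lemma tDD_X : tDD PowerSeries.X = 0 := by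
  ext1 n
  simp only [tDD, coeff_tw, PowerSeries.coeff_X]
  split_ifs <;> simp

lemma tdd_C (a : AA) : tdd (PowerSeries.C a) = PowerSeries.C (dd a) := by
  ext1 n
  simp only [tdd, coeff_tw, PowerSeries.coeff_C]
  split_ifs <;> simp

lemma tDD_C (a : AA) : tDD (PowerSeries.C a) = PowerSeries.C (DD a) := by
  ext1 n
  simp only [tDD, coeff_tw, PowerSeries.coeff_C]
  split_ifs <;> simp

lemma dd_X (k : ℕ) : dd (X k) = X (k+1) := by simp [dd]

/-- The quadratic first integral. -/
lemma first_integral (S : PowerSeries AA) (ε : ℝ) 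
    (h0 : S.map constantCoeff = 1)
    (hS : tdd S = PowerSeries.X * (PowerSeries.C (X 1) * S + 2 * PowerSeries.C (X 0) * tdd S
      + PowerSeries.C (C ε) * tdd (tdd (tdd S)))) :
    S * S = 2 * PowerSeries.X * (PowerSeries.C (X 0) * (S * S)) 
      + 2 * PowerSeries.X * (PowerSeries.C (C ε) * (S * tdd (tdd S)))
      - PowerSeries.X * (PowerSeries.C (C ε) * (tdd S * tdd S)) + 1 := by
  set Q := S * S - (PowerSeries.X * (PowerSeries.C (X 0) * (S * S)) 
      + PowerSeries.X * (PowerSeries.C (X 0) * (S * S)) 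
      + (PowerSeries.X * (PowerSeries.C (C ε) * (S * tdd (tdd S)))
        + PowerSeries.X * (PowerSeries.C (C ε) * (S * tdd (tdd S))))
      - PowerSeries.X * (PowerSeries.C (C ε) * (tdd S * tdd S))) with hQ
  have hd : tdd Q = 0 := by
    rw [hQ]
    simp only [map_sub, map_add, tdd_mul, tdd_X, tdd_C, dd_X, derivation_C, map_zero]
    linear_combination (2 * S) * hS
  have hc : Q.map constantCoeff = 1 := by
    have h1 : (tdd S).map constantCoeff = 0 := by
      ext n; simp [tdd, coeff_tw, cc_dd]
    rw [hQ]
    simp only [map_sub, map_add, map_mul, h0, h1, PowerSeries.map_C, constantCoeff_X]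
    have h2 : (tdd (tdd S)).map constantCoeff = 0 := by
      ext n; simp [tdd, coeff_tw, cc_dd]
    rw [h2]
    simp
  have hQ1 : Q = 1 := by
    ext1 n
    have e1 := congrArg (PowerSeries.coeff n) hd
    have e2 := congrArg (PowerSeries.coeff n) hc
    simp only [tdd, coeff_tw, map_zero] at e1
    have e3 := ker_dd _ e1
    rw [e3]
    rw [PowerSeries.coeff_map] at e2
    change MvPolynomial.coeff 0 (PowerSeries.coeff n Q) = _ at e2
    rw [e2, PowerSeries.coeff_one, PowerSeries.coeff_one]
    split_ifs <;> simp
  linear_combination hQ1 - hQ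

lemma linearized (S G : PowerSeries AA) (ε : ℝ) (hG : S * G = 1)
    (hS : S * S = 2 * PowerSeries.X * (PowerSeries.C (X 0) * (S * S)) 
      + 2 * PowerSeries.X * (PowerSeries.C (C ε) * (S * tdd (tdd S)))
      - PowerSeries.X * (PowerSeries.C (C ε) * (tdd S * tdd S)) + 1) :
    ∃ w, - tDD G = PowerSeries.X * iot S + PowerSeries.X * tnab w := by
  have h1 : iot S * iot G = 1 := by rw [← map_mul, hG, map_one]
  have hone : tDD (1 : PowerSeries AA) = 0 := by
    rw [← map_one PowerSeries.C, tDD_C]; simp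
  have h2 : iot S * tDD G + tDD S * iot G = 0 := by rw [← tDD_mul, hG, hone]
  have hiX : iot PowerSeries.X = PowerSeries.X := by simp [iot]
  have hiC (a : AA) : iot (PowerSeries.C a) = PowerSeries.C (Polynomial.C a) := by simp [iot]
  have hD0 : DD (X 0) = 1 := by simp [DD]
  obtain ⟨τ, hτ⟩ : ∃ τ, τ = iot G * tDD S := ⟨_, rfl⟩
  have hT : tDD S = iot S * τ := by rw [hτ]; linear_combination (-tDD S) * h1
  have hT1 : tnab (tDD S) = iot S * tnab τ + iot (tdd S) * τ := by rw [hT, tnab_mul]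
  have hT2 : tnab (tnab (tDD S)) = iot S * tnab (tnab τ) + 2 * iot (tdd S) * tnab τ
      + iot (tdd (tdd S)) * τ := by
    rw [hT1, map_add, tnab_mul, tnab_mul]; ring
  have hq := congrArg tDD hS
  have hq' := congrArg iot hS
  simp only [two_mul, add_mul, map_sub, map_add, tDD_mul, map_mul, tDD_X, tDD_C, hD0, hiX, hiC, hone,
    derivation_C, map_zero, tDD_tdd, map_one] at hq hq'
  rw [hT2, hT1, hT] at hq
  have hw : tnab (iot (PowerSeries.C (C ε)) * (iot S * tnab τ)) = 
     PowerSeries.C (Polynomial.C (C ε)) * (iot S * tnab (tnab τ) + iot (tdd S) * tnab τ) := by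
    rw [tnab_mul, tnab_mul, tdd_C, hiC]; simp
  refine ⟨iot (PowerSeries.C (C ε)) * (iot S * tnab τ), ?_⟩
  rw [hw]
  have h3 : τ = PowerSeries.X * (iot S * iot S) + PowerSeries.X * (iot S *
    (PowerSeries.C (Polynomial.C (C ε)) * (iot S * tnab (tnab τ) + iot (tdd S) * tnab τ))) := by
    have : (2 : PowerSeries (Polynomial AA)) * τ = 2 * (PowerSeries.X * (iot S * iot S) + PowerSeries.X * (iot S *
    (PowerSeries.C (Polynomial.C (C ε)) * (iot S * tnab (tnab τ) + iot (tdd S) * tnab τ)))) := by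
      linear_combination hq - 2 * τ * hq'
    have h2 : (2 : PowerSeries (Polynomial AA)) ≠ 0 := by
      intro h
      have := congrArg PowerSeries.constantCoeff h
      rw [map_ofNat, map_zero] at this
      exact two_ne_zero this
    exact mul_left_cancel₀ h2 this
  have h4 : - tDD G = iot G * τ := by
    rw [hτ]; linear_combination (-iot G) * h2 + (tDD G) * h1
  rw [h4]
  set N := iot S * tnab (tnab τ) + iot (tdd S) * tnab τ
  set K : PowerSeries (Polynomial AA) := PowerSeries.C (Polynomial.C (C ε))
  linear_combination (iot G) * h3 + (PowerSeries.X * iot S + PowerSeries.X * K * N) * h1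

lemma S_mem_im (S : PowerSeries AA) (ε : ℝ) 
    (h0 : S.map constantCoeff = 1) (h1 : PowerSeries.constantCoeff S = 1)
    (hS : tdd S = PowerSeries.X * (PowerSeries.C (X 1) * S + 2 * PowerSeries.C (X 0) * tdd S
      + PowerSeries.C (C ε) * tdd (tdd (tdd S)))) (n : ℕ) :
    ∃ g : AA, PowerSeries.coeff n S = Psi (DD g) := by
  have hG : S * S.invOfUnit 1 = 1 := PowerSeries.mul_invOfUnit S 1 (by simpa using h1)
  obtain ⟨w, hw⟩ := linearized S _ ε hG (first_integral S ε h0 hS)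
  have := congrArg (PowerSeries.coeff (n+1)) hw
  rw [map_neg, map_add, PowerSeries.coeff_succ_X_mul, PowerSeries.coeff_succ_X_mul] at this
  simp only [tDD, tnab, coeff_tw, iot, PowerSeries.coeff_map] at this
  have := congrArg Psi this
  refine ⟨-PowerSeries.coeff (n+1) (S.invOfUnit 1), ?_⟩
  rw [map_add, Psi_C] at this
  have h2 := Psi_nab (PowerSeries.coeff n w)
  change Psi (-DD _) = _ + Psi (nab _) at this
  rw [h2, add_zero] at this
  rw [← this, map_neg DD]

/-- the claim for a fixed value of `λ`. -/
lemma fixed_claim (r : ℕ → AA) (ε : ℝ) (h0 : r 0 = 1) (hc : ∀ n, 1 ≤ n → constantCoeff (r n) = 0)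
    (hr : ∀ n : ℕ, C (2 * (n : ℝ) + 1) * dd (r (n+1)) = X 1 * r n + C 2 * X 0 * dd (r n)
      + C ε * dd (dd (dd (r n)))) (n : ℕ) :
    Psi (DD (X 0 * r n)) = EE (r n) + r n := by
  let d : ℕ → ℝ := fun n => ∏ i ∈ Finset.range n, (2 * (i : ℝ) + 1)
  have hd : ∀ n, d (n+1) = (2 * (n : ℝ) + 1) * d n := by
    intro n; simp only [d]; rw [Finset.prod_range_succ, mul_comm]
  have hd0 : d 0 = 1 := by simp [d]
  have hdn : d n ≠ 0 := by
    apply Finset.prod_ne_zero_iff.2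
    intro i _; positivity
  let S : PowerSeries AA := PowerSeries.mk fun n => d n • r n
  obtain ⟨g, hg⟩ := S_mem_im S ε (by
      ext n
      rw [PowerSeries.coeff_map, PowerSeries.coeff_mk, PowerSeries.coeff_one]
      split_ifs with h
      · subst h; simp [h0, hd0]
      · simp [hc n (by omega)]) (by
      rw [← PowerSeries.coeff_zero_eq_constantCoeff_apply, PowerSeries.coeff_mk]; simp [h0, hd0])
    (by
      ext1 n
      cases n with
      | zero => simp [tdd, coeff_tw, S, h0, hd0]
      | succ n =>
        rw [PowerSeries.coeff_succ_X_mul, two_mul, add_mul]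
        simp only [map_add, PowerSeries.coeff_C_mul, tdd, coeff_tw, S, PowerSeries.coeff_mk]
        have h := congrArg (fun x => C (d n) * x) (hr n)
        beta_reduce at h
        change dd (d (n+1) • _) = X 1 * (d n • r n) + (X 0 * dd (d n • r n) + X 0 * dd (d n • r n))
          + C ε * dd (dd (dd (d n • r n)))
        simp only [Derivation.map_smul]
        simp only [hd, smul_eq_C_mul, map_mul]
        have h2 : (C 2 : AA) = 2 := map_ofNat C 2
        rw [h2] at h
        linear_combination h) n
  rw [PowerSeries.coeff_mk] at hg
  have hrn : r n = Psi (DD ((d n)⁻¹ • g)) := by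
    rw [Derivation.map_smul, map_smul, ← hg, smul_smul, inv_mul_cancel₀ hdn, one_smul]
  rw [hrn]
  exact Psi_DD_X0 _

lemma psum_eq_cw (L : AA →ₗ[ℝ] AA) (F : AA → AA) (h : ∀ a, F a = L a) (p : Polynomial AA) :
    (p.sum fun n a => Polynomial.C (F a) * Polynomial.X ^ n) = cw L p := by
  rw [cw, Polynomial.lsum_apply]
  simp only [h, Polynomial.C_mul_X_pow_eq_monomial]
  rfl

lemma dxP_eq (p : Polynomial AA) : dxP p = cw dd.toLinearMap p := psum_eq_cw _ _ dx_eq_s11 p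

lemma deltaP_eq (p : Polynomial AA) : deltaP p = cw (Psi ∘ₗ DD.toLinearMap) p :=
  psum_eq_cw _ _ delta_eq p

lemma eval_cw (L : AA →ₗ[ℝ] AA) (c : ℝ) (p : Polynomial AA) :
    (cw L p).eval (C c) = L (p.eval (C c)) := by
  induction p using Polynomial.induction_on' with
  | add p q hp hq => simp [hp, hq]
  | monomial n a =>
    rw [cw_monomial, Polynomial.eval_monomial, Polynomial.eval_monomial, ← map_pow, mul_comm,
      mul_comm a, ← smul_eq_C_mul, ← smul_eq_C_mul, map_smul]

lemma poly_ext {p q : Polynomial AA} (h : ∀ c : ℝ, p.eval (C c) = q.eval (C c)) : p = q := by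
  apply Polynomial.eq_of_infinite_eval_eq
  apply (Set.infinite_range_of_injective (MvPolynomial.C_injective ℕ ℝ)).mono
  rintro _ ⟨c, rfl⟩
  exact h c

lemma noconst_eval {p : Polynomial AA} (h : NoConst p) (c : ℝ) :
    constantCoeff (p.eval (C c)) = 0 := by
  rw [Polynomial.eval_eq_sum, Polynomial.sum_def, map_sum]
  apply Finset.sum_eq_zero
  intro k _
  have : constantCoeff (p.coeff k) = 0 := h k
  rw [map_mul, this, zero_mul]

lemma delta_EE (R : ℕ → Polynomial AA) (hR : IsGD R) (n : ℕ) :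
    deltaP (Polynomial.C (X 0) * R n) = cw EE.toLinearMap (R n) + R n := by
  obtain ⟨h0, h1, h2⟩ := hR
  apply poly_ext
  intro c
  rw [deltaP_eq, eval_cw, Polynomial.eval_add, eval_cw, Polynomial.eval_mul, Polynomial.eval_C]
  refine fixed_claim (fun n => (R n).eval (C c)) (1 / 4 * c ^ 2) (by simp [h0])
    (fun n hn => noconst_eval (h1 n hn) c) ?_ n
  intro n
  have := congrArg (Polynomial.eval (C c)) (h2 n)
  simp only [dxP_eq, Polynomial.eval_add, Polynomial.eval_mul, Polynomial.eval_C, eval_cw,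
    Polynomial.eval_pow, Polynomial.eval_X] at this
  rw [map_mul C (1 / 4 : ℝ), map_pow]
  exact this

lemma homog (R : ℕ → Polynomial AA) (hR : IsGD R) (n i : ℕ) :
    EE ((R n).coeff i) = ((n : ℝ) - i / 2) • (R n).coeff i := by
  obtain ⟨h0, h1, h2⟩ := hR
  induction n generalizing i with
  | zero =>
    rw [h0, Polynomial.coeff_one]
    split_ifs with h
    · subst h; simp
    · simp
  | succ n ih =>
    set a := (R (n+1)).coeff i with ha
    set s : ℝ := ((n + 1 : ℕ) : ℝ) - i / 2 with hs
    have hrec := congrArg (fun p => p.coeff i) (h2 n)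
    simp only [dxP_eq, Polynomial.coeff_add, Polynomial.coeff_C_mul, coeff_cw, mul_assoc,
      Polynomial.coeff_X_pow_mul'] at hrec
    have hE (x : AA) (k : ℕ) (y : AA) (hy : EE y = (s - 1) • y) (hx : x = X k * y) :
        EE x = s • x := by
      have : EE (X k) = X k := by simp [EE]
      rw [hx, Derivation.leibniz, hy, this, smul_eq_mul, smul_eq_mul, smul_eq_C_mul,
        smul_eq_C_mul, map_sub, map_one]
      ring
    have hi := ih i
    have hi1 : EE ((R n).coeff i) = (s - 1) • (R n).coeff i := by
      rw [hi, hs]; congr 1; push_cast; ring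
    have hi2 : EE (dd ((R n).coeff i)) = (s - 1) • dd ((R n).coeff i) := by
      rw [EE_dd, hi1, Derivation.map_smul]
    have hz : dd (EE a - s • a) = 0 := by
      have hne : (C (2 * (n : ℝ) + 1) : AA) ≠ 0 := by
        rw [Ne, C_eq_zero]; positivity
      apply (mul_eq_zero.1 _).resolve_left hne
      have key : EE (C (2 * (n : ℝ) + 1) * dd a) = s • (C (2 * (n : ℝ) + 1) * dd a) := by
        change C (2 * (n : ℝ) + 1) * dd a = _ at hrec
        rw [hrec]
        simp only [← smul_eq_C_mul]
        rw [map_add, map_add, smul_add, smul_add, hE _ 1 _ hi1 rfl, Derivation.map_smul,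
          Derivation.map_smul]
        have e2 := hE (X 0 * dd ((R n).coeff i)) 0 _ hi2 rfl
        congr 1
        · congr 1
          change (2:ℝ) • EE (X 0 * dd ((R n).coeff i)) = s • (2:ℝ) • (X 0 * dd ((R n).coeff i))
          rw [e2, smul_comm]
        · rw [smul_comm s]
          congr 1
          split_ifs with hle
          · change EE (dd (dd (dd _))) = s • dd (dd (dd _))
            rw [EE_dd, EE_dd, EE_dd, ih, Derivation.map_smul, Derivation.map_smul,
              Derivation.map_smul]
            congr 1
            rw [hs, Nat.cast_sub hle]; push_cast; ring
          · simp
      rw [← smul_eq_C_mul, Derivation.map_smul, EE_dd] at key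
      rw [← smul_eq_C_mul, map_sub, Derivation.map_smul, smul_sub, key, smul_comm, sub_self]
    have hk := ker_dd _ hz
    have hc : MvPolynomial.coeff 0 (EE a - s • a) = 0 := by
      have e1 : MvPolynomial.coeff 0 (EE a) = 0 := cc_EE a
      have e2 : MvPolynomial.coeff 0 a = 0 := h1 (n+1) (by omega) i
      rw [coeff_sub, coeff_smul, e1, e2]; simp
    rw [hc, C_0, sub_eq_zero] at hk
    exact hk

/-- `δ(u₀ · R_n) = (n+1) R_n − (λ/2) ∂R_n/∂λ` for every `n ≥ 0`. -/
theorem delta_u0_mul_gelfandDickey :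
    ∀ R : ℕ → Polynomial (MvPolynomial ℕ ℝ), IsGD R → ∀ n : ℕ,
      deltaP (Polynomial.C (X 0) * R n)
        = Polynomial.C (MvPolynomial.C ((n : ℝ) + 1)) * R n
          - Polynomial.C (MvPolynomial.C (1 / 2 : ℝ))
              * (Polynomial.X * Polynomial.derivative (R n)) := by
  intro R hR n
  rw [delta_EE R hR n]
  ext1 i
  rw [Polynomial.coeff_add, coeff_cw, Polynomial.coeff_sub, Polynomial.coeff_C_mul,
    Polynomial.coeff_C_mul]
  change EE ((R n).coeff i) + _ = _
  rw [homog R hR n i, smul_eq_C_mul]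
  cases i with
  | zero => simp; ring
  | succ i =>
    rw [Polynomial.coeff_X_mul, Polynomial.coeff_derivative]
    have e : ((i : AA) + 1) = C ((i : ℝ) + 1) := by simp
    have e2 : (C ((n : ℝ) - ((i + 1 : ℕ) : ℝ) / 2) : AA)
        = C ((n : ℝ) + 1) - 1 - C (1 / 2 : ℝ) * C ((i : ℝ) + 1) := by
      rw [← map_mul, ← map_one C, ← map_sub, ← map_sub]
      congr 1; push_cast; ring
    rw [e, e2]; ring
end

section
/- For every n ≥ 0, the variational derivative of T_n satisfies δ T_n = R_n − λ ∂R_n/∂λ, i.e. δT_n = (1 − λ ∂/∂λ) R_n, where ∂/∂λ is formal differentiation with respect to the indeterminate λ. -/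
open MvPolynomial

namespace GD

local notation "𝔸" => MvPolynomial ℕ ℝ

noncomputable def Dx : Derivation ℝ 𝔸 𝔸 := mkDerivation ℝ (fun k => X (k + 1))

lemma Dx_X (k : ℕ) : Dx (X k) = X (k + 1) := mkDerivation_X _ _ _

lemma exists_bound (f : 𝔸) : ∃ N : ℕ, ∀ k, N ≤ k → k ∉ f.vars := by
  refine ⟨f.vars.sup id + 1, fun k hk hm => ?_⟩
  have := Finset.le_sup (f := id) hm
  simp at this
  omega

lemma exists_bound' (f : 𝔸) : ∃ N : ℕ, ∀ k, N ≤ k → pderiv k f = 0 := by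
  obtain ⟨N, h⟩ := exists_bound f
  exact ⟨N, fun k hk => pderiv_eq_zero_of_notMem_vars (h k hk)⟩

/-- Any derivation is a finite sum of partial derivatives. -/
lemma der_eq_sum {M : Type*} [AddCommGroup M] [Module ℝ M] [Module 𝔸 M] [IsScalarTower ℝ 𝔸 M]
    (D : Derivation ℝ 𝔸 M) (f : 𝔸) (N : ℕ) (hN : ∀ k, N ≤ k → pderiv k f = 0) :
    D f = ∑ k ∈ Finset.range N, pderiv k f • D (X k) := by
  obtain ⟨N', h'⟩ := exists_bound f
  have key : ∀ K, (∀ k, K ≤ k → k ∉ f.vars) →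
      D f = ∑ k ∈ Finset.range K, pderiv k f • D (X k) := by
    intro K hK
    let D2 : Derivation ℝ 𝔸 M := ∑ k ∈ Finset.range K,
      ((LinearMap.toSpanSingleton 𝔸 M (D (X k))).compDer (pderiv k))
    have h2 : ∀ g, D2 g = ∑ k ∈ Finset.range K, pderiv k g • D (X k) := by
      intro g
      simp only [D2]
      have := map_sum (Derivation.coeFnAddMonoidHom (R := ℝ) (A := 𝔸) (M := M)) (fun k =>
        ((LinearMap.toSpanSingleton 𝔸 M (D (X k))).compDer (pderiv k))) (Finset.range K)
      have := congrFun this g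
      rw [Finset.sum_apply] at this
      exact this
    rw [← h2]
    apply derivation_eq_of_forall_mem_vars
    intro i hi
    have hiK : i < K := by
      by_contra hc
      exact hK i (by omega) hi
    rw [h2, Finset.sum_eq_single i]
    · simp
    · intro b _ hb
      rw [pderiv_X_of_ne (Ne.symm hb)]; simp
    · intro h; simp at h; omega
  rw [key (max N N') (fun k hk => h' k (le_trans (le_max_right _ _) hk))]
  symm
  apply Finset.sum_subset
  · intro x hx; simp at hx ⊢; left; exact hx
  · intro x _ hx
    simp at hx
    rw [hN x hx, zero_smul]

lemma finsum_range {M : Type*} [AddCommMonoid M] (g : ℕ → M) (N : ℕ) (h : ∀ k, N ≤ k → g k = 0) :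
    ∑ᶠ k, g k = ∑ k ∈ Finset.range N, g k := by
  apply finsum_eq_sum_of_support_subset
  intro k hk
  simp only [Finset.coe_range, Set.mem_Iio]
  by_contra hc
  exact hk (h k (by omega))

lemma dx_eq (f : 𝔸) : dx f = Dx f := by
  obtain ⟨N, h⟩ := exists_bound' f
  rw [dx, finsum_range _ N (fun k hk => by rw [h k hk, mul_zero]), der_eq_sum Dx f N h]
  simp [Dx_X, mul_comm]

lemma dx_fun : dx = Dx := funext dx_eq

lemma pderiv_Dx_succ (k : ℕ) (f : 𝔸) :
    pderiv (k + 1) (Dx f) = Dx (pderiv (k + 1) f) + pderiv k f := by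
  have h : ⁅pderiv (R := ℝ) (k + 1), Dx⁆ = pderiv k := by
    apply derivation_ext
    intro i
    rw [Derivation.commutator_apply, Dx_X]
    simp only [pderiv_X, Pi.single_apply]
    split_ifs <;> simp_all
  have := congrArg (fun D => D f) h
  simp only [Derivation.commutator_apply] at this
  rw [← this]; ring

lemma pderiv_of_Dx_zero (f : 𝔸) (hf : Dx f = 0) (k : ℕ) : pderiv k f = 0 := by
  obtain ⟨N, h⟩ := exists_bound' f
  have : ∀ j k, N ≤ k + j → pderiv k f = 0 := by
    intro j
    induction j with
    | zero => intro k hk; exact h k hk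
    | succ j ih =>
      intro k hk
      have h1 := ih (k + 1) (by omega)
      have h2 := pderiv_Dx_succ k f
      rw [hf, h1] at h2
      simpa using h2.symm
  exact this N k (by omega)

lemma eq_C_of_pderiv (f : 𝔸) (h : ∀ k, pderiv k f = 0) : f = C (coeff 0 f) := by
  ext m
  rw [coeff_C]
  split_ifs with hm
  · rw [hm]
  · obtain ⟨k, hk⟩ : ∃ k, m k ≠ 0 := by
      by_contra hc
      push Not at hc
      exact hm (by ext k; simp [hc k])
    have := coeff_pderiv (i := k) f (m - Finsupp.single k 1)
    rw [h k, tsub_add_cancel_of_le (by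
      rw [Finsupp.single_le_iff]; omega)] at this
    simp only [coeff_zero] at this
    have h3 := (mul_eq_zero.mp this.symm)
    rcases h3 with h3 | h3
    · exact h3
    · exfalso
      simp at h3
      norm_cast at h3

lemma eq_C_of_Dx (f : 𝔸) (h : Dx f = 0) : f = C (coeff 0 f) :=
  eq_C_of_pderiv f (pderiv_of_Dx_zero f h)

lemma coeff_zero_Dx (f : 𝔸) : coeff 0 (Dx f) = 0 := by
  obtain ⟨N, h⟩ := exists_bound' f
  rw [der_eq_sum Dx f N h, coeff_sum]
  apply Finset.sum_eq_zero
  intro k _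
  rw [Dx_X, smul_eq_mul, ← constantCoeff_eq]
  simp

/-- Fréchet derivative, with symbol variable `p`. -/
noncomputable def Fd : Derivation ℝ 𝔸 (Polynomial 𝔸) := mkDerivation ℝ (fun k => Polynomial.X ^ k)

lemma Fd_X (k : ℕ) : Fd (X k) = Polynomial.X ^ k := mkDerivation_X _ _ _

/-- coefficientwise extension of `Dx` to `𝔸[p]`. -/
noncomputable def Dp : Polynomial 𝔸 →ₗ[ℝ] Polynomial 𝔸 :=
  Polynomial.lsum fun k => (Polynomial.monomial k).restrictScalars ℝ ∘ₗ Dx.toLinearMap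

lemma Dp_monomial (k : ℕ) (a : 𝔸) :
    Dp (Polynomial.monomial k a) = Polynomial.monomial k (Dx a) := by
  simp [Dp, Polynomial.lsum, Polynomial.sum_monomial_index]

lemma Dp_mul (f g : Polynomial 𝔸) : Dp (f * g) = f * Dp g + Dp f * g := by
  induction f using Polynomial.induction_on' with
  | add p q hp hq => simp only [add_mul, map_add, hp, hq]; ring
  | monomial n a =>
    induction g using Polynomial.induction_on' with
    | add p q hp hq => simp only [mul_add, map_add, hp, hq]; ring
    | monomial m b =>
      simp only [Polynomial.monomial_mul_monomial, Dp_monomial, Derivation.leibniz, smul_eq_mul,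
        map_add]
      rw [mul_comm b]

/-- adjoint evaluation `p ↦ -∂ₓ`. -/
noncomputable def Ev : Polynomial 𝔸 →ₗ[ℝ] 𝔸 :=
  Polynomial.lsum fun k => (-Dx.toLinearMap) ^ k

lemma Ev_monomial (k : ℕ) (a : 𝔸) :
    Ev (Polynomial.monomial k a) = ((-Dx.toLinearMap) ^ k : 𝔸 →ₗ[ℝ] 𝔸) a := by
  simp [Ev, Polynomial.lsum, Polynomial.sum_monomial_index]

lemma Ev_C (a : 𝔸) : Ev (Polynomial.C a) = a := by
  rw [← Polynomial.monomial_zero_left, Ev_monomial]; simp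

lemma Ev_D (f : Polynomial 𝔸) : Ev (Dp f + Polynomial.X * f) = 0 := by
  induction f using Polynomial.induction_on' with
  | add p q hp hq =>
    have : Dp (p + q) + Polynomial.X * (p + q) = (Dp p + Polynomial.X * p) +
      (Dp q + Polynomial.X * q) := by rw [map_add]; ring
    rw [this, map_add, hp, hq, add_zero]
  | monomial n a =>
    rw [Polynomial.X_mul_monomial, map_add, Dp_monomial, Ev_monomial, Ev_monomial, pow_succ]
    simp

lemma Fd_Dx (f : 𝔸) : Fd (Dx f) = Dp (Fd f) + Polynomial.X * Fd f := by
  induction f using MvPolynomial.induction_on with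
  | C a => simp
  | add p q hp hq => simp only [map_add, hp, hq]; ring
  | mul_X p n hp =>
    have e (a : 𝔸) (q : Polynomial 𝔸) : a • q = Polynomial.C a * q := Polynomial.smul_eq_C_mul a
    have hX : Dp (Polynomial.X ^ n) = 0 := by
      rw [← Polynomial.monomial_one_right_eq_X_pow, Dp_monomial]; simp
    have hC (a : 𝔸) : Dp (Polynomial.C a) = Polynomial.C (Dx a) := by
      rw [← Polynomial.monomial_zero_left, Dp_monomial, Polynomial.monomial_zero_left]
    simp only [Derivation.leibniz, Dx_X, Fd_X, smul_eq_mul, map_add, hp, e, Dp_mul, hX, hC,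
      map_mul]
    ring

lemma negpow (k : ℕ) (a : 𝔸) :
    ((-Dx.toLinearMap) ^ k : 𝔸 →ₗ[ℝ] 𝔸) a = ((-1 : ℝ) ^ k) • (Dx^[k] a) := by
  induction k generalizing a with
  | zero => simp
  | succ k ih =>
    rw [pow_succ, Module.End.mul_apply, ih, Function.iterate_succ_apply, LinearMap.neg_apply]
    have : Dx^[k] (-(Dx.toLinearMap a)) = - Dx^[k] (Dx a) := by
      exact iterate_map_neg Dx k (Dx a)
    rw [this, pow_succ]; simp

lemma delta_eq (f : 𝔸) : delta f = Ev (Fd f) := by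
  obtain ⟨N, h⟩ := exists_bound' f
  rw [delta, dx_fun, finsum_range _ N (fun k hk => by
    rw [h k hk, ← negpow, map_zero]), der_eq_sum Fd f N h, map_sum]
  apply Finset.sum_congr rfl
  intro k _
  rw [Fd_X, Polynomial.smul_eq_C_mul, Polynomial.C_mul_X_pow_eq_monomial, Ev_monomial, negpow]

noncomputable def Del : 𝔸 →ₗ[ℝ] 𝔸 := Ev ∘ₗ Fd.toLinearMap

lemma delta_eq' (f : 𝔸) : delta f = Del f := delta_eq f

lemma Del_Dx (f : 𝔸) : Del (Dx f) = 0 := by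
  show Ev (Fd (Dx f)) = 0
  rw [Fd_Dx, Ev_D]

lemma Del_C (c : ℝ) : Del (C c) = 0 := by
  show Ev (Fd (C c)) = 0
  simp

lemma abstract_key {S : Type*} [CommRing S] (δ : S →+ S)
    (hmul : ∀ a b, δ (a * b) = a * δ b + δ a * b)
    (w ε u p r s g k : S) (hw : δ w = 0) (hε : δ ε = 0) (hp : δ p = 0) (hrs : r * s = 1)
    (hQ : w * (ε * (2 * r * δ (δ r) - δ r * δ r) + 2 * u * (r * r)) - r * r = -1)
    (h1 : w * (ε * (r * (δ (δ (r * g) + p * (r * g)) + p * (δ (r * g) + p * (r * g)))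
        + (r * g) * δ (δ r) - δ r * (δ (r * g) + p * (r * g))) + 2 * u * (r * (r * g)) + r * r)
        - r * (r * g) = 0)
    (h2 : 2 * (w * (ε * (r * δ (δ (r * k)) + (r * k) * δ (δ r) - δ r * δ (r * k))
        + 2 * u * (r * (r * k))) - r * (r * k)) + r * r - 1 = 0) :
    ∃ Z, r * g = 2 * w * (r * k) + w * r + (δ Z + p * Z) := by
  have e1 : -g + w * ε * r * (δ (r * (δ g + p * g)) + p * (r * (δ g + p * g))) + w * (r * r) = 0 := by
    simp only [hmul, map_add, hp] at h1 ⊢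
    linear_combination h1 - g * hQ
  have e2 : 2 * (-k + w * ε * r * (δ (r * δ k))) + r * r - 1 = 0 := by
    simp only [hmul, map_add, hp] at h2 ⊢
    linear_combination h2 - 2 * k * hQ
  refine ⟨w * ε * (r * (δ g + p * g)) + (w * ε * (r * (k * (δ g + p * g) - g * δ k))
    + w * ε * (r * (k * (δ g + p * g) - g * δ k))), ?_⟩
  have hu : IsUnit r := IsUnit.of_mul_eq_one s hrs
  apply hu.mul_left_cancel
  simp only [hmul, map_add, map_sub, hp, hw, hε] at e1 e2 ⊢
  linear_combination - (2 * k * e1 - g * e2 + e1)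

section lift
variable {B D : Type*} [CommRing B] [CommRing D]

noncomputable def lft (f : B →+ D) : PowerSeries B →+ PowerSeries D where
  toFun φ := PowerSeries.mk fun n => f (PowerSeries.coeff n φ)
  map_zero' := by ext n; simp
  map_add' a b := by ext n; simp

lemma coeff_lft (f : B →+ D) (φ : PowerSeries B) (n : ℕ) :
    PowerSeries.coeff n (lft f φ) = f (PowerSeries.coeff n φ) := by
  simp [lft]

lemma lft_mul (f : B →+ D) (ι : B →+* D) (h : ∀ a b, f (a * b) = ι a * f b + f a * ι b)
    (φ ψ : PowerSeries B) :
    lft f (φ * ψ) = PowerSeries.map ι φ * lft f ψ + lft f φ * PowerSeries.map ι ψ := by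
  ext n
  simp only [coeff_lft, PowerSeries.coeff_mul, map_add, map_sum, h, PowerSeries.coeff_map,
    Finset.sum_add_distrib]

lemma lft_C (f : B →+ D) (b : B) : lft f (PowerSeries.C b) = PowerSeries.C (f b) := by
  ext n
  rw [coeff_lft, PowerSeries.coeff_C, PowerSeries.coeff_C]
  split_ifs <;> simp

lemma lft_X (f : B →+ D) (h : f 1 = 0) : lft f PowerSeries.X = 0 := by
  ext n
  rw [coeff_lft, PowerSeries.coeff_X]
  split_ifs <;> simp [h]

lemma lft_deriv (f : B →+ B) (φ : PowerSeries B) :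
    lft f (PowerSeries.derivative B φ) = PowerSeries.derivative B (lft f φ) := by
  ext n
  rw [coeff_lft, PowerSeries.coeff_derivative, PowerSeries.coeff_derivative, coeff_lft]
  have : ∀ a : B, a * ((n : B) + 1) = (n + 1) • a := by intro a; simp [mul_comm]
  rw [this, this, map_nsmul]
end lift

noncomputable def DX : 𝔸 →+ 𝔸 := Dx.toLinearMap.toAddMonoidHom
noncomputable def DP : Polynomial 𝔸 →+ Polynomial 𝔸 := Dp.toAddMonoidHom
noncomputable def FD : 𝔸 →+ Polynomial 𝔸 := Fd.toLinearMap.toAddMonoidHom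
lemma DX_apply (a : 𝔸) : DX a = Dx a := rfl
lemma DP_apply (a : Polynomial 𝔸) : DP a = Dp a := rfl
lemma FD_apply (a : 𝔸) : FD a = Fd a := rfl

lemma LDX_mul (a b : PowerSeries 𝔸) : lft DX (a * b) = a * lft DX b + lft DX a * b := by
  have := lft_mul DX (RingHom.id 𝔸) (fun a b => by
    simp only [DX_apply, Derivation.leibniz, smul_eq_mul, RingHom.id_apply]; ring) a b
  simpa using this

lemma LDP_mul (a b : PowerSeries (Polynomial 𝔸)) :
    lft DP (a * b) = a * lft DP b + lft DP a * b := by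
  have := lft_mul DP (RingHom.id _) (fun a b => by
    simp only [DP_apply, Dp_mul, RingHom.id_apply]) a b
  simpa using this

local notation "ι" => PowerSeries.map (Polynomial.C (R := MvPolynomial ℕ ℝ))

lemma LFD_mul (a b : PowerSeries 𝔸) : lft FD (a * b) = ι a * lft FD b + lft FD a * ι b := by
  apply lft_mul FD Polynomial.C
  intro a b
  simp only [FD_apply, Derivation.leibniz, Polynomial.smul_eq_C_mul]; ring

lemma Dp_C (a : 𝔸) : Dp (Polynomial.C a) = Polynomial.C (Dx a) := by
  rw [← Polynomial.monomial_zero_left, Dp_monomial, Polynomial.monomial_zero_left]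

lemma ι_DX (a : PowerSeries 𝔸) : ι (lft DX a) = lft DP (ι a) := by
  ext1 n
  simp only [PowerSeries.coeff_map, coeff_lft, DX_apply, DP_apply, Dp_C]

lemma LFD_DX (a : PowerSeries 𝔸) :
    lft FD (lft DX a) = lft DP (lft FD a) + PowerSeries.C Polynomial.X * lft FD a := by
  ext1 n
  simp only [coeff_lft, map_add, PowerSeries.coeff_C_mul, FD_apply, DX_apply, DP_apply, Fd_Dx]

lemma Q_const (e : ℝ) (r : PowerSeries 𝔸) (hc : PowerSeries.map constantCoeff r = 1)
    (hr : lft DX r = PowerSeries.X * (PowerSeries.C (C e) * lft DX (lft DX (lft DX r))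
      + 2 * PowerSeries.C (X 0) * lft DX r + PowerSeries.C (X 1) * r)) :
    PowerSeries.X * (PowerSeries.C (C e) * (2 * r * lft DX (lft DX r) - lft DX r * lft DX r)
      + 2 * PowerSeries.C (X 0) * (r * r)) - r * r = -1 := by
  set Q := PowerSeries.X * (PowerSeries.C (C e) * (2 * r * lft DX (lft DX r) - lft DX r * lft DX r)
      + 2 * PowerSeries.C (X 0) * (r * r)) - r * r with hQdef
  have hX : lft DX PowerSeries.X = 0 := lft_X DX (by simp [DX_apply])
  have he : lft DX (PowerSeries.C (C e)) = 0 := by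
    rw [lft_C, DX_apply, derivation_C, map_zero]
  have hu : lft DX (PowerSeries.C (X 0)) = PowerSeries.C (X 1) := by
    rw [lft_C, DX_apply, Dx_X]
  have h2 : lft DX (2 : PowerSeries 𝔸) = 0 := by
    have : (2 : PowerSeries 𝔸) = PowerSeries.C (C 2) := by
      rw [map_ofNat C 2, map_ofNat]
    rw [this, lft_C, DX_apply, derivation_C, map_zero]
  have hQ : lft DX Q = 0 := by
    rw [hQdef]
    simp only [map_sub, map_add, LDX_mul, hX, he, hu, h2]
    linear_combination (-2 * r) * hr
  have hcQ : PowerSeries.map constantCoeff Q = -1 := by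
    have h0 : ∀ f : PowerSeries 𝔸, PowerSeries.map constantCoeff (lft DX f) = 0 := by
      intro f
      ext n
      simp only [PowerSeries.coeff_map, coeff_lft, DX_apply, constantCoeff_eq, coeff_zero_Dx,
        map_zero]
    rw [hQdef]
    simp only [map_sub, map_add, map_mul, h0, hc, PowerSeries.map_C, constantCoeff_X]
    simp
  ext1 n
  have h3 := congrArg (PowerSeries.coeff n) hQ
  rw [coeff_lft, DX_apply, map_zero] at h3
  have h4 := congrArg (PowerSeries.coeff n) hcQ
  rw [PowerSeries.coeff_map, constantCoeff_eq] at h4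
  rw [eq_C_of_Dx _ h3, h4]
  simp only [map_neg, PowerSeries.coeff_one]
  split_ifs <;> simp

lemma delta_series (e : ℝ) (r : PowerSeries 𝔸) (hc : PowerSeries.map constantCoeff r = 1)
    (h0 : PowerSeries.constantCoeff r = 1)
    (hr : lft DX r = PowerSeries.X * (PowerSeries.C (C e) * lft DX (lft DX (lft DX r))
      + 2 * PowerSeries.C (X 0) * lft DX r + PowerSeries.C (X 1) * r)) (n : ℕ) :
    Del (PowerSeries.coeff (n + 1) r) = (2 * (n : ℝ) + 1) • PowerSeries.coeff n r := by
  have hQ := Q_const e r hc hr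
  -- the inverse of r
  obtain ⟨s, hs⟩ : ∃ s, r * s = 1 := by
    have : IsUnit r := PowerSeries.isUnit_iff_constantCoeff.mpr (by rw [h0]; exact isUnit_one)
    exact this.exists_right_inv
  have hs' : ι r * ι s = 1 := by rw [← map_mul, hs, map_one]
  set t := PowerSeries.derivative 𝔸 r with ht
  set ρ := lft FD r with hρ
  have hg : ι r * (ι s * ρ) = ρ := by rw [← mul_assoc, hs', one_mul]
  have hk : ι r * (ι s * ι (PowerSeries.X * t)) = ι (PowerSeries.X * t) := by
    rw [← mul_assoc, hs', one_mul]
  have two : (2 : PowerSeries 𝔸) = PowerSeries.C (C 2) := by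
      rw [map_ofNat C 2, map_ofNat]
  obtain ⟨Z, hZ⟩ := abstract_key (lft DP) LDP_mul PowerSeries.X (PowerSeries.C (Polynomial.C (C e)))
    (PowerSeries.C (Polynomial.C (X 0))) (PowerSeries.C Polynomial.X) (ι r) (ι s) (ι s * ρ)
    (ι s * ι (PowerSeries.X * t))
    (lft_X _ (by rw [DP_apply, ← Polynomial.C_1, Dp_C]; simp))
    (by rw [lft_C, DP_apply, Dp_C]; simp)
    (by rw [lft_C, DP_apply, ← Polynomial.monomial_one_one_eq_X, Dp_monomial]; simp) hs'
    (by
      have := congrArg ι hQ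
      simpa only [map_sub, map_add, map_mul, map_neg, map_one, PowerSeries.map_X, PowerSeries.map_C,
        ι_DX, map_ofNat] using this)
    (by
      rw [hg]
      have h := congrArg (lft FD) hQ
      have hX : lft FD PowerSeries.X = 0 := lft_X FD (by simp [FD_apply])
      have he : lft FD (PowerSeries.C (C e)) = 0 := by
        rw [lft_C, FD_apply, derivation_C, map_zero]
      have hu : lft FD (PowerSeries.C (X 0)) = 1 := by
        rw [lft_C, FD_apply, Fd_X]; simp
      have h2 : lft FD (2 : PowerSeries 𝔸) = 0 := by
        rw [two, lft_C, FD_apply, derivation_C, map_zero]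
      have h1 : lft FD (-1 : PowerSeries 𝔸) = 0 := by
        have : (1 : PowerSeries 𝔸) = PowerSeries.C (C 1) := by simp
        rw [map_neg, this, lft_C, FD_apply, derivation_C, map_zero, neg_zero]
      rw [h1] at h
      simp only [map_sub, map_add, LFD_mul, hX, he, hu, h2, LFD_DX, ι_DX, map_mul, PowerSeries.map_X,
        PowerSeries.map_C, map_ofNat, ← hρ] at h
      have h20 : (2 : PowerSeries (Polynomial 𝔸)) ≠ 0 := by
        intro h
        have := congrArg PowerSeries.constantCoeff h
        rw [map_ofNat, map_zero] at this
        exact two_ne_zero this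
      apply mul_left_cancel₀ h20
      simp only [map_add]
      linear_combination h)
    (by
      rw [hk]
      have h := congrArg (fun q => PowerSeries.X * PowerSeries.derivative 𝔸 q) hQ
      have h1 : PowerSeries.derivative 𝔸 (-1) = 0 := by
        rw [map_neg, PowerSeries.derivative_one, neg_zero]
      have h2 : PowerSeries.derivative 𝔸 (2 : PowerSeries 𝔸) = 0 := by
        rw [two, PowerSeries.derivative_C]
      simp only [map_sub, map_add, Derivation.leibniz, smul_eq_mul, PowerSeries.derivative_C,
        PowerSeries.derivative_X, ← lft_deriv, h1, h2, ← ht] at h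
      have hX : lft DX PowerSeries.X = 0 := lft_X DX (by simp [DX_apply])
      have key : 2 * (PowerSeries.X * (PowerSeries.C (C e) * (r * lft DX (lft DX (PowerSeries.X * t))
        + (PowerSeries.X * t) * lft DX (lft DX r) - lft DX r * lft DX (PowerSeries.X * t))
        + 2 * PowerSeries.C (X 0) * (r * (PowerSeries.X * t))) - r * (PowerSeries.X * t))
        + r * r - 1 = 0 := by
        simp only [LDX_mul, hX, map_add, map_zero, zero_mul, add_zero]
        linear_combination h - hQ
      have := congrArg ι key
      simpa only [map_sub, map_add, map_mul, map_neg, map_one, PowerSeries.map_X, PowerSeries.map_C,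
        ι_DX, map_ofNat, map_zero] using this)
  rw [hg, hk] at hZ
  have h := congrArg (fun q => Ev (PowerSeries.coeff (n + 1) q)) hZ
  have e1 : 2 * PowerSeries.X * ι (PowerSeries.X * t) + PowerSeries.X * ι r
      = PowerSeries.X * ι (2 * (PowerSeries.X * t) + r) := by
    simp only [map_add, map_mul, map_ofNat]; ring
  rw [e1] at h
  simp only [map_add, PowerSeries.coeff_succ_X_mul, coeff_lft, PowerSeries.coeff_C_mul,
    PowerSeries.coeff_map] at h
  rw [← map_add Ev (DP _), DP_apply, Ev_D, add_zero, ← map_add, ← map_add, Ev_C] at h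
  show Ev (Fd _) = _
  rw [hρ, coeff_lft, FD_apply] at h
  rw [h, two, PowerSeries.coeff_C_mul]
  cases n with
  | zero => simp
  | succ m =>
    rw [PowerSeries.coeff_succ_X_mul, ht, PowerSeries.coeff_derivative, MvPolynomial.smul_eq_C_mul]
    push_cast
    simp only [map_add, map_mul, map_natCast, map_one]
    ring

lemma der_C_mul (D : Derivation ℝ 𝔸 𝔸) (a : ℝ) (f : 𝔸) : D (C a * f) = C a * D f := by
  simp [Derivation.leibniz]

lemma Del_R (e : ℝ) (R : ℕ → 𝔸) (h0 : R 0 = 1) (hc : ∀ n, 1 ≤ n → coeff 0 (R n) = 0)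
    (hrec : ∀ n : ℕ, C (2 * (n : ℝ) + 1) * Dx (R (n + 1)) =
      X 1 * R n + C 2 * X 0 * Dx (R n) + C e * Dx (Dx (Dx (R n)))) (n : ℕ) :
    Del (R (n + 1)) = R n := by
  let c : ℕ → ℝ := fun n => ∏ i ∈ Finset.range n, (2 * (i : ℝ) + 1)
  have hcs : ∀ n, c (n + 1) = c n * (2 * (n : ℝ) + 1) := fun n => Finset.prod_range_succ _ _
  have hpos : ∀ n, c n ≠ 0 := fun n => Finset.prod_ne_zero_iff.mpr (fun i _ => by positivity)
  have hc0 : c 0 = 1 := Finset.prod_range_zero _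
  let r : PowerSeries 𝔸 := PowerSeries.mk fun n => C (c n) * R n
  have hco : ∀ n, PowerSeries.coeff n r = C (c n) * R n := fun n => PowerSeries.coeff_mk _ _
  have two : (2 : PowerSeries 𝔸) = PowerSeries.C (C 2) := by
    rw [map_ofNat C 2, map_ofNat]
  have main := delta_series e r (by
      ext n
      rw [PowerSeries.coeff_map, hco, map_mul, constantCoeff_C, PowerSeries.coeff_one]
      split_ifs with h
      · rw [h, hc0, h0]; simp
      · rw [constantCoeff_eq, hc n (by omega), mul_zero])
    (by rw [← PowerSeries.coeff_zero_eq_constantCoeff_apply, hco, hc0, h0]; simp)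
    (by
      ext1 n
      cases n with
      | zero =>
        rw [coeff_lft, hco, h0, DX_apply]
        simp
      | succ m =>
        rw [PowerSeries.coeff_succ_X_mul, two]
        simp only [map_add, PowerSeries.coeff_C_mul, coeff_lft, DX_apply, hco, mul_assoc,
          der_C_mul]
        rw [hcs, map_mul C]
        linear_combination C (c m) * hrec m) n
  rw [hco, hco, ← MvPolynomial.smul_eq_C_mul, ← MvPolynomial.smul_eq_C_mul, map_smul, hcs,
    smul_smul, mul_comm (c n)] at main
  have : (2 * (n : ℝ) + 1) * c n ≠ 0 := mul_ne_zero (by positivity) (hpos n)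
  exact smul_right_injective _ this main

section lam

lemma coeff_sumC (f : 𝔸 →ₗ[ℝ] 𝔸) (p : Polynomial 𝔸) (i : ℕ) :
    (p.sum fun n a => Polynomial.C (f a) * Polynomial.X ^ n).coeff i = f (p.coeff i) := by
  rw [Polynomial.sum_def, Polynomial.finset_sum_coeff]
  simp only [Polynomial.coeff_C_mul_X_pow]
  rw [Finset.sum_ite_eq]
  split_ifs with h
  · rfl
  · rw [Polynomial.notMem_support_iff.mp h, map_zero]

lemma coeff_dxP (p : Polynomial 𝔸) (i : ℕ) : (dxP p).coeff i = Dx (p.coeff i) := by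
  rw [dxP, dx_fun]
  exact coeff_sumC Dx.toLinearMap p i

lemma coeff_deltaP (p : Polynomial 𝔸) (i : ℕ) : (deltaP p).coeff i = Del (p.coeff i) := by
  have : delta = Del := funext delta_eq'
  rw [deltaP, this]
  exact coeff_sumC Del p i

lemma eval_lin (f : 𝔸 →ₗ[ℝ] 𝔸) (p q : Polynomial 𝔸) (h : ∀ i, q.coeff i = f (p.coeff i)) (c : ℝ) :
    q.eval (C c) = f (p.eval (C c)) := by
  have hp := Polynomial.eval_eq_sum_range' (p := p)
    (n := max p.natDegree q.natDegree + 1) (by omega) (C c)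
  have hq := Polynomial.eval_eq_sum_range' (p := q)
    (n := max p.natDegree q.natDegree + 1) (by omega) (C c)
  rw [hp, hq, map_sum]
  apply Finset.sum_congr rfl
  intro i _
  rw [h, ← map_pow, mul_comm, ← MvPolynomial.smul_eq_C_mul, mul_comm,
    ← MvPolynomial.smul_eq_C_mul, map_smul]

lemma eval_dxP (p : Polynomial 𝔸) (c : ℝ) : (dxP p).eval (C c) = Dx (p.eval (C c)) :=
  eval_lin Dx.toLinearMap p _ (coeff_dxP p) c

lemma deltaP_R (R : ℕ → Polynomial 𝔸) (h : IsGD R) (n : ℕ) : deltaP (R (n + 1)) = R n := by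
  obtain ⟨h0, hc, hrec⟩ := h
  apply Polynomial.eq_of_infinite_eval_eq
  apply Set.Infinite.mono (s := Set.range (C : ℝ → 𝔸))
  · rintro _ ⟨c, rfl⟩
    show (deltaP (R (n + 1))).eval (C c) = (R n).eval (C c)
    rw [eval_lin Del _ _ (coeff_deltaP _) c]
    refine Del_R (1 / 4 * c ^ 2) (fun n => (R n).eval (C c)) (by simp [h0]) ?_ ?_ n
    · intro m hm
      show coeff 0 ((R m).eval (C c)) = 0
      rw [Polynomial.eval_eq_sum_range, coeff_sum]
      apply Finset.sum_eq_zero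
      intro i _
      rw [← map_pow, mul_comm, coeff_C_mul, hc m hm i, mul_zero]
    · intro m
      have := congrArg (Polynomial.eval (C c)) (hrec m)
      simp only [Polynomial.eval_add, Polynomial.eval_mul, Polynomial.eval_C, Polynomial.eval_pow,
        Polynomial.eval_X, eval_dxP] at this
      rw [this, map_mul, map_pow]
  · exact Set.infinite_range_of_injective (C_injective ℕ ℝ)

/-- weight derivation. -/
noncomputable def W : Derivation ℝ 𝔸 𝔸 := mkDerivation ℝ (fun k => C (k : ℝ) * X k)

lemma W_X (k : ℕ) : W (X k) = C (k : ℝ) * X k := mkDerivation_X _ _ _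

lemma W_Dx (f : 𝔸) : W (Dx f) = Dx (W f) + Dx f := by
  have h : ⁅W, Dx⁆ = Dx := by
    apply derivation_ext
    intro i
    rw [Derivation.commutator_apply, Dx_X, W_X, W_X, der_C_mul, Dx_X]
    push_cast
    simp only [map_add, map_one]
    ring
  have := congrArg (fun D => D f) h
  simp only [Derivation.commutator_apply] at this
  linear_combination this

lemma coeff_zero_W (f : 𝔸) : coeff 0 (W f) = 0 := by
  obtain ⟨N, h⟩ := exists_bound' f
  rw [der_eq_sum W f N h, coeff_sum]
  apply Finset.sum_eq_zero
  intro k _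
  rw [W_X, smul_eq_mul, ← constantCoeff_eq]
  simp

lemma W_R (R : ℕ → Polynomial 𝔸) (h : IsGD R) (n : ℕ) :
    ∀ i, W ((R n).coeff i) = C (i : ℝ) * (R n).coeff i := by
  obtain ⟨h0, hc, hrec⟩ := h
  induction n with
  | zero =>
    intro i
    rw [h0, Polynomial.coeff_one]
    split_ifs with hi
    · rw [hi]; simp
    · simp
  | succ n ih =>
    intro i
    -- the coefficient of `λ^(i-2)`
    obtain ⟨q, hq, hWq⟩ : ∃ q : 𝔸, (Polynomial.X ^ 2 * dxP (dxP (dxP (R n)))).coeff i = Dx (Dx (Dx q))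
        ∧ W q = C ((i : ℝ) - 2) * q := by
      rw [Polynomial.coeff_X_pow_mul']
      split_ifs with hi
      · refine ⟨(R n).coeff (i - 2), by simp only [coeff_dxP], ?_⟩
        rw [ih, Nat.cast_sub hi, Nat.cast_ofNat]
      · exact ⟨0, by simp, by simp⟩
    have hr := congrArg (fun p => Polynomial.coeff p i) (hrec n)
    simp only [Polynomial.coeff_add, mul_assoc, Polynomial.coeff_C_mul, hq, coeff_dxP] at hr
    set a := (R n).coeff i with ha
    set b := (R (n + 1)).coeff i with hb
    have hWa : W a = C (i : ℝ) * a := ih i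
    have hW := congrArg W hr
    have hz : C (2 * (n : ℝ) + 1) * Dx (W b - C (i : ℝ) * b) = 0 := by
      simp only [map_add, map_sub, Derivation.leibniz, smul_eq_mul, W_X, W_Dx, hWa,
        hWq, Nat.cast_zero, Nat.cast_one, map_zero, map_one,
        derivation_C] at hW hr ⊢
      have hC2 : (C 2 : 𝔸) = 2 := map_ofNat C 2
      have hW1 : W 1 = 0 := Derivation.map_one_eq_zero W
      ring_nf at hW hr ⊢
      linear_combination hW - (C (i : ℝ) + 1) * hr - Dx b * hW1 - C (1 / 4) * Dx (Dx (Dx q)) * hC2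
    have hz2 : Dx (W b - C (i : ℝ) * b) = 0 := by
      rcases mul_eq_zero.mp hz with h | h
      · exfalso
        rw [MvPolynomial.C_eq_zero] at h
        have : (0 : ℝ) < 2 * (n : ℝ) + 1 := by positivity
        linarith
      · exact h
    have := eq_C_of_Dx _ hz2
    rw [coeff_sub, coeff_zero_W, coeff_C_mul, hc (n + 1) (by omega) i] at this
    rw [mul_zero, sub_zero, map_zero] at this
    linear_combination this

lemma Del_parts (f g : 𝔸) : Del (f * Dx g) = - Del (Dx f * g) := by
  have := Del_Dx (f * g)
  rw [Derivation.leibniz, map_add, smul_eq_mul, smul_eq_mul, mul_comm g] at this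
  linear_combination this

lemma exists_y (k : ℕ) : ∀ a : 𝔸, ∃ y, Dx y = X (k + 1) * a
    - X 1 * ((-Dx.toLinearMap) ^ k : 𝔸 →ₗ[ℝ] 𝔸) a ∧ Del y = (k : ℝ) • Del (X k * a) := by
  induction k with
  | zero => intro a; exact ⟨0, by simp, by simp⟩
  | succ k ih =>
    intro a
    obtain ⟨y, hy, hy2⟩ := ih (Dx a)
    refine ⟨X (k + 1) * a - y, ?_, ?_⟩
    · rw [map_sub, hy, Derivation.leibniz, Dx_X, pow_succ, Module.End.mul_apply, LinearMap.neg_apply,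
        map_neg]
      have e : Dx.toLinearMap a = Dx a := rfl
      simp only [smul_eq_mul, e]
      ring
    · rw [map_sub, hy2, Del_parts, Dx_X]
      push_cast
      module

lemma Del_T (t h : 𝔸) (ht : Dx t = X 1 * Del h) : Del t = Del (h - W h) := by
  obtain ⟨N, hN⟩ := exists_bound' h
  choose y hy hy2 using fun k => exists_y k (pderiv k h)
  have hD := der_eq_sum Dx h N hN
  have hW := der_eq_sum W h N hN
  have hF : Del h = ∑ k ∈ Finset.range N, ((-Dx.toLinearMap) ^ k : 𝔸 →ₗ[ℝ] 𝔸) (pderiv k h) := by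
    show Ev (Fd h) = _
    rw [der_eq_sum Fd h N hN, map_sum]
    apply Finset.sum_congr rfl
    intro k _
    rw [Fd_X, Polynomial.smul_eq_C_mul, Polynomial.C_mul_X_pow_eq_monomial, Ev_monomial]
  have hz : Dx (t - (h - ∑ k ∈ Finset.range N, y k)) = 0 := by
    rw [map_sub, map_sub, map_sum, Finset.sum_congr rfl (fun k _ => hy k), Finset.sum_sub_distrib,
      ← Finset.mul_sum, ← hF, ht, hD]
    simp only [Dx_X, smul_eq_mul, mul_comm (X _) (pderiv _ _)]
    ring
  have h1 := congrArg Del (eq_C_of_Dx _ hz)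
  rw [Del_C, map_sub, map_sub, map_sum, Finset.sum_congr rfl (fun k _ => hy2 k)] at h1
  have h2 : Del (W h) = ∑ k ∈ Finset.range N, (k : ℝ) • Del (X k * pderiv k h) := by
    rw [hW, map_sum]
    apply Finset.sum_congr rfl
    intro k _
    rw [← map_smul Del, W_X, MvPolynomial.smul_eq_C_mul]
    congr 1
    simp only [smul_eq_mul]
    ring
  rw [map_sub, h2]
  linear_combination h1

end lam

end GD

/-- `δ T_n = (1 − λ ∂/∂λ) R_n` for every `n ≥ 0`. -/
theorem delta_T :
    ∀ R T : ℕ → Polynomial (MvPolynomial ℕ ℝ), IsGD R → IsT R T → ∀ n : ℕ,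
      deltaP (T n) = R n - Polynomial.X * Polynomial.derivative (R n) := by
  intro R T hR hT n
  ext1 i
  have hd : ∀ i, GD.Del ((R (n + 1)).coeff i) = (R n).coeff i := fun i => by
    rw [← GD.coeff_deltaP, GD.deltaP_R R hR n]
  have ht : GD.Dx ((T n).coeff i) = X 1 * GD.Del ((R (n + 1)).coeff i) := by
    rw [hd, ← GD.coeff_dxP, (hT n).2, Polynomial.coeff_C_mul]
  rw [GD.coeff_deltaP, GD.Del_T _ _ ht, GD.W_R R hR, map_sub, ← MvPolynomial.smul_eq_C_mul, map_smul,
    hd, Polynomial.coeff_sub]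
  congr 1
  cases i with
  | zero => simp
  | succ i =>
    rw [Polynomial.coeff_X_mul, Polynomial.coeff_derivative, MvPolynomial.smul_eq_C_mul]
    push_cast
    simp only [map_add, map_natCast, map_one]
    ring
end
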